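/- Let Λ be the limit set of a CIFS with fixed point set F. Then dim_LB Λ = dim_UB Λ if and only if dim_UB F ≤ max{dim_H Λ, dim_LB F}. -/

import Mathlib

open Set Metric Filter Topology MeasureTheory

noncomputable section

/-- Least number of open balls of radius `r` needed to cover `E`. -/
def coveringNumber {α : Type*} [PseudoMetricSpace α] (E : Set α) (r : ℝ) : ℕ :=
  sInf {n : ℕ | ∃ t : Finset α, t.card = n ∧ E ⊆ ⋃ x ∈ t, Metric.ball x r}

/-- `s_E(r) = log N_r(E) / log (1/r)`. -/
def sFun {α : Type*} [PseudoMetricSpace α] (E : Set α) (r : ℝ) : ℝ :=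
  Real.log (coveringNumber E r) / Real.log (1 / r)

/-- Lower box dimension. -/
def dimLB {α : Type*} [PseudoMetricSpace α] (E : Set α) : ℝ :=
  Filter.liminf (fun r => sFun E r) (nhdsWithin (0 : ℝ) (Set.Ioi 0))

/-- Upper box dimension. -/
def dimUB {α : Type*} [PseudoMetricSpace α] (E : Set α) : ℝ :=
  Filter.limsup (fun r => sFun E r) (nhdsWithin (0 : ℝ) (Set.Ioi 0))

/-- Upper right Dini derivative. -/
def upperDini (g : ℝ → ℝ) (x : ℝ) : ℝ :=
  Filter.limsup (fun h => (g (x + h) - g x) / h) (nhdsWithin (0 : ℝ) (Set.Ioi 0))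

/-- The class `𝒢(λ, α)`. -/
def GClass (lam alp : ℝ) : Set (ℝ → ℝ) :=
  {g | Continuous g ∧ (∀ x, g x ∈ Set.Icc lam alp) ∧
    ∀ x, upperDini g x ∈ Set.Icc (lam - g x) (alp - g x)}

/-- Asymptotic equivalence of two functions. -/
def AsympEquiv (f g : ℝ → ℝ) : Prop :=
  Filter.Tendsto (fun x => f x - g x) Filter.atTop (nhds 0)

/-- `E` has covering class `g`. -/
def HasCoveringClass {α : Type*} [PseudoMetricSpace α] (E : Set α) (g : ℝ → ℝ) : Prop :=
  AsympEquiv (fun x => sFun E (Real.exp (-Real.exp x))) g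

/-- Composition of the maps indexed by a finite word. -/
def compMaps {α : Type*} {I : Type*} (T : I → α → α) : List I → α → α
  | [] => id
  | i :: w => T i ∘ compMaps T w

/-- A conformal iterated function system on `ℝ^d` satisfying the open set condition
and the cone condition. -/
structure CIFS (d : ℕ) where
  /-- the compact seed set -/
  X : Set (EuclideanSpace ℝ (Fin d))
  /-- the countable index set -/
  I : Type
  /-- the contractions -/
  S : I → EuclideanSpace ℝ (Fin d) → EuclideanSpace ℝ (Fin d)
  hXcompact : IsCompact X
  hXconn : IsConnected X
  hXint : (interior X).Nonempty
  hIcount : Countable I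
  hInonempty : Nonempty I
  hSmaps : ∀ i, Set.MapsTo (S i) X X
  /-- the uniform contraction ratio -/
  c : ℝ
  hc0 : 0 < c
  hc1 : c < 1
  hcontr : ∀ i, ∀ x ∈ X, ∀ y ∈ X,
    (x ≠ y → 0 < dist (S i x) (S i y)) ∧ dist (S i x) (S i y) ≤ c * dist x y
  /-- the open connected set on which the maps extend conformally -/
  V : Set (EuclideanSpace ℝ (Fin d))
  hVopen : IsOpen V
  hVbdd : Bornology.IsBounded V
  hVconn : IsConnected V
  hXV : X ⊆ V
  /-- the conformal extensions -/
  T : I → EuclideanSpace ℝ (Fin d) → EuclideanSpace ℝ (Fin d)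
  hTagree : ∀ i, ∀ x ∈ X, T i x = S i x
  hTmaps : ∀ i, Set.MapsTo (T i) V V
  hTinj : ∀ i, Set.InjOn (T i) V
  /-- the Hölder exponent in `C^{1+ε}` -/
  eps : ℝ
  heps : 0 < eps
  hTdiff : ∀ i, ContDiffOn ℝ 1 (T i) V
  hTholder : ∀ i, ∃ C : ℝ, 0 < C ∧ ∀ x ∈ V, ∀ y ∈ V,
    ‖fderiv ℝ (T i) x - fderiv ℝ (T i) y‖ ≤ C * ‖x - y‖ ^ eps
  hTconf : ∀ i, ∀ x ∈ V, IsConformalMap (fderiv ℝ (T i) x)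
  /-- the bounded distortion constant -/
  K : ℝ
  hK : 1 ≤ K
  hBD : ∀ w : List I, ∀ x ∈ V, ∀ y ∈ V,
    ‖fderiv ℝ (compMaps T w) x‖ ≤ K * ‖fderiv ℝ (compMaps T w) y‖
  hOSCin : ∀ i, S i '' interior X ⊆ interior X
  hOSCdisj : ∀ i j, i ≠ j → Disjoint (S i '' interior X) (S j '' interior X)
  hCone : ∃ κ : ℝ, 0 < κ ∧ ∀ x ∈ X, ∀ r : ℝ, 0 < r → r < 1 →
    ENNReal.ofReal (κ * r ^ d) ≤ volume (Metric.ball x r ∩ interior X)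

/-- The limit set (attractor) of a CIFS. -/
def CIFS.limitSet {d : ℕ} (Φ : CIFS d) : Set (EuclideanSpace ℝ (Fin d)) :=
  ⋃ γ : ℕ → Φ.I, ⋂ n : ℕ, compMaps Φ.S (List.ofFn fun k : Fin (n + 1) => γ k) '' Φ.X

/-- The set of fixed points of the maps of a CIFS. -/
def CIFS.fixedPoints {d : ℕ} (Φ : CIFS d) : Set (EuclideanSpace ℝ (Fin d)) :=
  {x | x ∈ Φ.X ∧ ∃ i, Φ.S i x = x}

/-- `ρ(w) = sup_{x ∈ X} ‖S'_w(x)‖`. -/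
def CIFS.rho {d : ℕ} (Φ : CIFS d) (w : List Φ.I) : ℝ :=
  sSup ((fun x => ‖fderiv ℝ (compMaps Φ.T w) x‖) '' Φ.X)

/-- `Ψ(r, θ) = (1 - θ)·dim_H Λ + θ·s_F(r^θ)`. -/
def CIFS.Psi {d : ℕ} (Φ : CIFS d) (r θ : ℝ) : ℝ :=
  (1 - θ) * (dimH Φ.limitSet).toReal + θ * sFun Φ.fixedPoints (r ^ θ)

/-- `ψ(r) = max_{θ ∈ [0,1]} Ψ(r,θ)` (which equals the supremum over `θ ∈ (0,1]`,
since `Ψ(r,0)` is defined as the limit of `Ψ(r,θ)` as `θ → 0⁺`). -/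
def CIFS.psi {d : ℕ} (Φ : CIFS d) (r : ℝ) : ℝ :=
  sSup (Φ.Psi r '' Set.Ioc (0 : ℝ) 1)

/-- The interval `𝒟(h, s, t, α)`. -/
def Dset (h s t α : ℝ) : Set ℝ :=
  if t ≤ h then {h}
  else Set.Icc (max h s) (h + (t - h) * (α - h) * s / (α * t - h * s))

/-- The quantity whose limit as `θ → 1⁻` is the quasi-Assouad dimension. -/
def quasiAssouadAux {α : Type*} [PseudoMetricSpace α] (E : Set α) (θ : ℝ) : ℝ :=
  sInf {t : ℝ | 0 ≤ t ∧ ∃ C : ℝ, 0 < C ∧ ∀ x ∈ E, ∀ r R : ℝ,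
    0 < r → r ≤ R ^ (1 / θ) → R ^ (1 / θ) ≤ R → R < 1 →
    (coveringNumber (E ∩ Metric.ball x R) r : ℝ) ≤ C * (R / r) ^ t}

/-- The quasi-Assouad dimension. -/
def dimqA {α : Type*} [PseudoMetricSpace α] (E : Set α) : ℝ :=
  Filter.limsup (quasiAssouadAux E) (nhdsWithin (1 : ℝ) (Set.Iio 1))

/-- The modified lower box dimension. -/
def dimLMB {α : Type*} [PseudoMetricSpace α] (K : Set α) : ℝ :=
  sInf {s : ℝ | ∃ C : ℕ → Set α, (K ⊆ ⋃ i, C i) ∧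
    (∀ i, (C i).Nonempty ∧ Bornology.IsBounded (C i)) ∧ s = ⨆ i, dimLB (C i)}

/-- The unit cube `[0,1]^d`. -/
def unitCube (d : ℕ) : Set (EuclideanSpace ℝ (Fin d)) :=
  {x | ∀ j, x j ∈ Set.Icc (0 : ℝ) 1}

/-- The basic similarity maps in the homogeneous Moran construction. -/
def moranMap (d : ℕ) (r : ℝ) (i : Fin d → Bool)
    (x : EuclideanSpace ℝ (Fin d)) : EuclideanSpace ℝ (Fin d) :=
  (EuclideanSpace.equiv (Fin d) ℝ).symm (fun j => r * x j + (if i j then 1 - r else 0))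

/-- The `n`-th level of the homogeneous Moran construction. -/
def moranLevel (d : ℕ) : (ℕ → ℝ) → ℕ → Set (EuclideanSpace ℝ (Fin d))
  | _, 0 => unitCube d
  | r, n + 1 => ⋃ i : Fin d → Bool, moranMap d (r 1) i '' moranLevel d (fun k => r (k + 1)) n

/-- The homogeneous Moran set `M(r)`. -/
def moranSet (d : ℕ) (r : ℕ → ℝ) : Set (EuclideanSpace ℝ (Fin d)) :=
  ⋂ n, moranLevel d r (n + 1)

/-- The Gauss map `x ↦ 1/x - ⌊1/x⌋`. -/
def gaussMap (x : ℝ) : ℝ := Int.fract (1 / x)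

/-- The `n`-th partial quotient (continued fraction digit) of `x` (`n = 0` gives `b₁ = ⌊1/x⌋`). -/
def cfDigit (x : ℝ) (n : ℕ) : ℤ := ⌊1 / gaussMap^[n] x⌋

/-- The set of irrationals in `(0,1)` all of whose continued fraction digits lie in `I`. -/
def cfSet (I : Set ℕ) : Set ℝ :=
  {x | x ∈ Set.Ioo (0 : ℝ) 1 ∧ Irrational x ∧ ∀ n : ℕ, ∃ b ∈ I, cfDigit x n = (b : ℤ)}

/-- A family of maps with derivative bounded by `M` on a neighbourhood `V` of a compact connected
set `X` is uniformly Lipschitz on `X`, up to a constant depending only on `X` and `V`. -/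
theorem exists_dist_le_of_norm_fderiv_le {E : Type*} [NormedAddCommGroup E] [NormedSpace ℝ E]
    {X V : Set E} (hX : IsCompact X) (hXc : IsConnected X) (hV : IsOpen V) (hXV : X ⊆ V) :
    ∃ C : ℝ, 0 < C ∧ ∀ (f : E → E) (M : ℝ), (∀ x ∈ V, DifferentiableAt ℝ f x) →
      (∀ x ∈ V, ‖fderiv ℝ f x‖ ≤ M) → ∀ x ∈ X, ∀ y ∈ X, dist (f x) (f y) ≤ C * M * dist x y := by
  obtain ⟨δ, hδ, hδV⟩ := hX.exists_thickening_subset_open hV hXV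
  have hloc : ∀ (f : E → E) (M : ℝ), (∀ x ∈ V, DifferentiableAt ℝ f x) →
      (∀ x ∈ V, ‖fderiv ℝ f x‖ ≤ M) → ∀ x ∈ X, ∀ y, dist x y < δ →
      dist (f x) (f y) ≤ M * dist x y := by
    intro f M hd hM x hx y hxy
    have hb : ball x δ ⊆ V := (ball_subset_thickening hx δ).trans hδV
    have := (convex_ball x δ).norm_image_sub_le_of_norm_fderiv_le (𝕜 := ℝ) (f := f)
      (fun z hz => hd z (hb hz)) (fun z hz => hM z (hb hz))
      (mem_ball'.2 hxy) (mem_ball_self hδ)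
    rwa [dist_eq_norm, dist_eq_norm]
  obtain ⟨x₀, hx₀⟩ := hXc.nonempty
  let P : E → E → Prop := fun x y => ∃ C : ℝ, 0 ≤ C ∧ ∀ (f : E → E) (M : ℝ),
    (∀ x ∈ V, DifferentiableAt ℝ f x) → (∀ x ∈ V, ‖fderiv ℝ f x‖ ≤ M) →
      dist (f x) (f y) ≤ C * M
  have hP : ∀ y ∈ X, P x₀ y := by
    intro y hy
    refine hXc.isPreconnected.induction₂ P ?_ ?_ ?_ hx₀ hy
    · intro x hx
      filter_upwards [mem_nhdsWithin_of_mem_nhds (ball_mem_nhds x hδ)] with z hz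
      have hz' : dist x z < δ := mem_ball'.1 hz
      refine ⟨dist x z, dist_nonneg, fun f M hd hM => ?_⟩
      simpa [mul_comm] using hloc f M hd hM x hx z hz'
    · rintro x y z - - - ⟨C, hC, h1⟩ ⟨C', hC', h2⟩
      refine ⟨C + C', by positivity, fun f M hd hM => ?_⟩
      linarith [dist_triangle (f x) (f y) (f z), h1 f M hd hM, h2 f M hd hM]
    · rintro x y - - ⟨C, hC, h1⟩
      exact ⟨C, hC, fun f M hd hM => by simpa [dist_comm] using h1 f M hd hM⟩
  obtain ⟨C, hC, hCX⟩ : ∃ C : ℝ, 0 ≤ C ∧ ∀ y ∈ X, ∀ (f : E → E) (M : ℝ),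
      (∀ x ∈ V, DifferentiableAt ℝ f x) → (∀ x ∈ V, ‖fderiv ℝ f x‖ ≤ M) →
      dist (f x₀) (f y) ≤ C * M := by
    refine hX.induction_on (p := fun s => ∃ C : ℝ, 0 ≤ C ∧ ∀ y ∈ s, ∀ (f : E → E) (M : ℝ),
      (∀ x ∈ V, DifferentiableAt ℝ f x) → (∀ x ∈ V, ‖fderiv ℝ f x‖ ≤ M) →
      dist (f x₀) (f y) ≤ C * M) ⟨0, le_rfl, by simp⟩ ?_ ?_ ?_
    · rintro s t hst ⟨C, hC, h⟩
      exact ⟨C, hC, fun y hy => h y (hst hy)⟩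
    · rintro s t ⟨C, hC, h⟩ ⟨C', hC', h'⟩
      refine ⟨C + C', by positivity, fun y hy f M hd hM => ?_⟩
      have hM0 : 0 ≤ M := (norm_nonneg _).trans (hM x₀ (hXV hx₀))
      rcases hy with hy | hy
      · nlinarith [h y hy f M hd hM]
      · nlinarith [h' y hy f M hd hM]
    · intro x hx
      obtain ⟨C, hC, h⟩ := hP x hx
      refine ⟨ball x δ, mem_nhdsWithin_of_mem_nhds (ball_mem_nhds x hδ), C + δ, by positivity,
        fun y hy f M hd hM => ?_⟩
      have hM0 : 0 ≤ M := (norm_nonneg _).trans (hM x₀ (hXV hx₀))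
      have hy' : dist x y < δ := mem_ball'.1 hy
      nlinarith [dist_triangle (f x₀) (f x) (f y), h f M hd hM, hloc f M hd hM x hx y hy']
  refine ⟨1 + 2 * C / δ, by positivity, fun f M hd hM x hx y hy => ?_⟩
  have hM0 : 0 ≤ M := (norm_nonneg _).trans (hM x₀ (hXV hx₀))
  rcases lt_or_ge (dist x y) δ with h | h
  · have := hloc f M hd hM x hx y h
    have h2 : 0 ≤ 2 * C / δ * (M * dist x y) := by positivity
    nlinarith
  · have h1 := hCX x hx f M hd hM
    have h2 := hCX y hy f M hd hM
    have h3 := dist_triangle_left (f x) (f y) (f x₀)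
    have h4 : 2 * C * M ≤ 2 * C / δ * M * dist x y := by
      rw [div_mul_eq_mul_div, div_mul_eq_mul_div, le_div_iff₀ hδ]
      gcongr
    have h5 : 0 ≤ M * dist x y := by positivity
    nlinarith

/-- Quantitative surjectivity: a map whose derivative expands by at least `m` in every direction
of the target covers a ball of definite size. -/
theorem exists_preimage_of_expanding_fderiv {E : Type*} [NormedAddCommGroup E] [NormedSpace ℝ E]
    [FiniteDimensional ℝ E] {f : E → E} {x q : E} {δ m : ℝ} (hδ : 0 < δ) (hm : 0 < m)
    (hf : ∀ z ∈ closedBall x δ, DifferentiableAt ℝ f z)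
    (hexp : ∀ z ∈ closedBall x δ, ∀ v, m * ‖v‖ ≤ ‖fderiv ℝ f z v‖)
    (hq : dist q (f x) < m / 2 * δ) :
    ∃ z ∈ closedBall x δ, f z = q ∧ m / 2 * dist z x ≤ dist q (f x) := by
  have hcont : ContinuousOn (fun z => ‖f z - q‖ + m / 2 * ‖z - x‖) (closedBall x δ) := by
    have : ContinuousOn f (closedBall x δ) := fun z hz => (hf z hz).continuousAt.continuousWithinAt
    fun_prop
  obtain ⟨z, hz, hmin⟩ := (isCompact_closedBall x δ).exists_isMinOn
    ⟨x, mem_closedBall_self hδ.le⟩ hcont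
  have hzx := isMinOn_iff.1 hmin x (mem_closedBall_self hδ.le)
  simp only [sub_self, norm_zero, mul_zero, add_zero] at hzx
  rw [dist_eq_norm, norm_sub_rev] at hq
  have hlt : ‖z - x‖ < δ := by
    have : m / 2 * ‖z - x‖ < m / 2 * δ := by linarith [norm_nonneg (f z - q)]
    exact lt_of_mul_lt_mul_left this (by positivity)
  have key : f z = q := by
    by_contra hne
    have hpos : 0 < ‖f z - q‖ := norm_pos_iff.2 (sub_ne_zero.2 hne)
    have hinj : Function.Injective (fderiv ℝ f z : E →ₗ[ℝ] E) := by
      rw [← LinearMap.ker_eq_bot, LinearMap.ker_eq_bot']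
      intro v hv
      have h1 := hexp z hz v
      have : fderiv ℝ f z v = 0 := hv
      rw [this, norm_zero] at h1
      have : ‖v‖ ≤ 0 := by nlinarith [norm_nonneg v]
      simpa using this
    obtain ⟨v, hv⟩ := LinearMap.injective_iff_surjective.1 hinj (q - f z)
    have hv : fderiv ℝ f z v = q - f z := hv
    have hvn : m * ‖v‖ ≤ ‖f z - q‖ := by
      have := hexp z hz v
      rwa [hv, norm_sub_rev] at this
    have hline : HasDerivAt (fun s : ℝ => f (z + s • v)) (q - f z) 0 := by
      have h1 : HasDerivAt (fun s : ℝ => z + s • v) v 0 := by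
        simpa using ((hasDerivAt_id (0 : ℝ)).smul_const v).const_add z
      have h2 : HasFDerivAt f (fderiv ℝ f z) (z + (0 : ℝ) • v) := by
        simpa using (hf z hz).hasFDerivAt
      rw [← hv]
      exact h2.comp_hasDerivAt 0 h1
    have hlo := hasDerivAt_iff_isLittleO.1 hline
    have hev := hlo.def (c := ‖f z - q‖ / 4) (by positivity)
    have hin : ∀ᶠ s : ℝ in 𝓝 0, z + s • v ∈ closedBall x δ := by
      have hc : ContinuousAt (fun s : ℝ => z + s • v) 0 := by fun_prop
      refine hc.eventually_mem ?_
      simp only [zero_smul, add_zero]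
      exact closedBall_mem_nhds_of_mem (mem_ball_iff_norm.2 hlt)
    have hsmall : ∀ᶠ s : ℝ in 𝓝[>] 0, s < 1 :=
      (eventually_lt_nhds one_pos).filter_mono nhdsWithin_le_nhds
    obtain ⟨s, hs1, hs2, hs3, hs0⟩ := ((hev.filter_mono nhdsWithin_le_nhds).and
      ((hin.filter_mono nhdsWithin_le_nhds).and (hsmall.and self_mem_nhdsWithin))).exists
    have hs0 : 0 < s := hs0
    simp only [zero_smul, add_zero, sub_zero] at hs1
    rw [Real.norm_of_nonneg hs0.le] at hs1
    have hle := isMinOn_iff.1 hmin _ hs2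
    have e1 : ‖f (z + s • v) - q‖ ≤ ‖f (z + s • v) - f z - s • (q - f z)‖ +
        (1 - s) * ‖f z - q‖ := by
      have : f (z + s • v) - q =
          (f (z + s • v) - f z - s • (q - f z)) + (1 - s) • (f z - q) := by module
      calc ‖f (z + s • v) - q‖ = _ := by rw [this]
        _ ≤ _ := norm_add_le _ _
        _ = _ := by rw [norm_smul, Real.norm_of_nonneg (by linarith : (0 : ℝ) ≤ 1 - s)]
    have e2 : ‖z + s • v - x‖ ≤ ‖z - x‖ + s * ‖v‖ := by
      have : z + s • v - x = (z - x) + s • v := by abel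
      rw [this]
      refine (norm_add_le _ _).trans ?_
      rw [norm_smul, Real.norm_of_nonneg hs0.le]
    have e3 : m / 2 * ‖z + s • v - x‖ ≤ m / 2 * ‖z - x‖ + s * ‖f z - q‖ / 2 := by
      nlinarith
    nlinarith
  refine ⟨z, hz, key, ?_⟩
  rw [dist_eq_norm, dist_eq_norm, norm_sub_rev q]
  linarith [norm_nonneg (f z - q)]

/-- Packing bound, uniform over all scales. -/
theorem exists_card_le_of_separated {E : Type*} [NormedAddCommGroup E] [NormedSpace ℝ E]
    [FiniteDimensional ℝ E] (R : ℝ) {b : ℝ} (hb : 0 < b) :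
    ∃ M : ℕ, ∀ (ι : Type) (s : Finset ι) (f : ι → E) (p : E) (σ : ℝ), 0 < σ →
      (∀ i ∈ s, dist (f i) p ≤ R * σ) →
      (∀ i ∈ s, ∀ j ∈ s, i ≠ j → b * σ ≤ dist (f i) (f j)) → s.card ≤ M := by
  obtain ⟨t, -, htf, ht⟩ := finite_cover_balls_of_compact (isCompact_closedBall (0 : E) R)
    (half_pos hb)
  refine ⟨htf.toFinset.card, fun ι s f p σ hσ h1 h2 => ?_⟩
  have hex : ∀ i ∈ s, ∃ c ∈ t, dist (σ⁻¹ • (f i - p)) c < b / 2 := by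
    intro i hi
    have : σ⁻¹ • (f i - p) ∈ closedBall (0 : E) R := by
      rw [mem_closedBall_zero_iff, norm_smul, norm_inv, Real.norm_of_nonneg hσ.le, ← dist_eq_norm,
        inv_mul_le_iff₀ hσ, mul_comm]
      exact h1 i hi
    simpa using ht this
  choose! c hct hc using hex
  refine Finset.card_le_card_of_injOn c (fun i hi => by simpa using hct i hi) ?_
  intro i hi j hj hij
  by_contra hne
  have h3 := h2 i hi j hj hne
  have h4 := dist_triangle_right (σ⁻¹ • (f i - p)) (σ⁻¹ • (f j - p)) (c i)
  have h5 := hc j hj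
  rw [← hij] at h5
  have h6 : dist (σ⁻¹ • (f i - p)) (σ⁻¹ • (f j - p)) = σ⁻¹ * dist (f i) (f j) := by
    rw [dist_smul₀, norm_inv, Real.norm_of_nonneg hσ.le, dist_sub_right]
  have h7 : b ≤ σ⁻¹ * dist (f i) (f j) := by
    rw [le_inv_mul_iff₀ hσ, mul_comm]; exact h3
  linarith [hc i hi]

/-- A finite set in which every point has at most `M` neighbours contains an independent subset
of proportion at least `1 / M`. -/
theorem Finset.exists_independent_subset {ι : Type*} (r : ι → ι → Prop) (M : ℕ)
    (hrefl : ∀ i, r i i) (hsymm : ∀ i j, r i j → r j i) (A : Finset ι)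
    (hM : ∀ i ∈ A, ∀ s ⊆ A, (∀ j ∈ s, r j i) → s.card ≤ M) :
    ∃ B ⊆ A, A.card ≤ M * B.card ∧ ∀ i ∈ B, ∀ j ∈ B, i ≠ j → ¬ r i j := by
  classical
  induction A using Finset.strongInduction with
  | H A ih =>
    rcases A.eq_empty_or_nonempty with rfl | ⟨i, hi⟩
    · exact ⟨∅, by simp⟩
    · have hss : A.filter (fun j => ¬ r j i) ⊂ A := by
        rw [Finset.filter_ssubset]
        exact ⟨i, hi, not_not.2 (hrefl i)⟩
      obtain ⟨B, hB, hc, hind⟩ := ih _ hss (fun j hj s hs h =>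
        hM j (hss.1 hj) s (hs.trans hss.1) h)
      have hiB : i ∉ B := fun h => (Finset.mem_filter.1 (hB h)).2 (hrefl i)
      refine ⟨insert i B, ?_, ?_, ?_⟩
      · exact Finset.insert_subset hi (hB.trans hss.1)
      · rw [Finset.card_insert_of_notMem hiB]
        have h1 := hM i hi (A.filter (fun j => r j i)) (Finset.filter_subset _ _)
          (fun j hj => (Finset.mem_filter.1 hj).2)
        have h2 := Finset.card_filter_add_card_filter_not (s := A) (fun j => r j i)
        nlinarith
      · intro j hj k hk hjk
        rw [Finset.mem_insert] at hj hk
        rcases hj with rfl | hj <;> rcases hk with rfl | hk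
        · exact absurd rfl hjk
        · exact fun h => (Finset.mem_filter.1 (hB hk)).2 (hsymm _ _ h)
        · exact (Finset.mem_filter.1 (hB hj)).2
        · exact hind j hj k hk hjk

/-- `x` lies in the image of `X` under every finite truncation of the coding sequence `σ`. -/
def IsCodedBy {α I : Type*} (f : I → α → α) (X : Set α) (σ : ℕ → I) (x : α) : Prop :=
  ∀ n : ℕ, x ∈ compMaps f (List.ofFn fun k : Fin n => σ k) '' X

theorem compMaps_append {α I : Type*} (f : I → α → α) (u v : List I) :
    compMaps f (u ++ v) = compMaps f u ∘ compMaps f v := by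
  induction u with
  | nil => rfl
  | cons i u ih => simp [compMaps, ih, Function.comp_assoc]

theorem compMaps_mapsTo {α I : Type*} {f : I → α → α} {X : Set α} (h : ∀ i, MapsTo (f i) X X)
    (w : List I) : MapsTo (compMaps f w) X X := by
  induction w with
  | nil => exact mapsTo_id X
  | cons i w ih => exact (h i).comp ih

theorem compMaps_injOn {α I : Type*} {f : I → α → α} {X : Set α} (h : ∀ i, MapsTo (f i) X X)
    (hinj : ∀ i, InjOn (f i) X) (w : List I) : InjOn (compMaps f w) X := by
  induction w with
  | nil => exact injOn_id X
  | cons i w ih => exact (hinj i).comp ih (compMaps_mapsTo h w)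

theorem compMaps_continuousOn {α I : Type*} [TopologicalSpace α] {f : I → α → α} {X : Set α}
    (h : ∀ i, MapsTo (f i) X X) (hc : ∀ i, ContinuousOn (f i) X) (w : List I) :
    ContinuousOn (compMaps f w) X := by
  induction w with
  | nil => exact continuousOn_id
  | cons i w ih => exact (hc i).comp ih (compMaps_mapsTo h w)

theorem IsCodedBy.mem {α I : Type*} {f : I → α → α} {X : Set α} {σ : ℕ → I} {x : α}
    (h : IsCodedBy f X σ x) : x ∈ X := by
  simpa [compMaps] using h 0

theorem IsCodedBy.exists_tail {α I : Type*} {f : I → α → α} {X : Set α} {σ : ℕ → I} {x : α}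
    (hf : ∀ i, MapsTo (f i) X X) (hinj : ∀ i, InjOn (f i) X) (h : IsCodedBy f X σ x) :
    ∃ y, IsCodedBy f X (fun k => σ (k + 1)) y ∧ x = f (σ 0) y := by
  have h' : ∀ n : ℕ, ∃ y ∈ compMaps f (List.ofFn fun k : Fin n => σ (k + 1)) '' X,
      x = f (σ 0) y := by
    intro n
    obtain ⟨z, hz, hzx⟩ := h (n + 1)
    rw [List.ofFn_succ] at hzx
    exact ⟨_, ⟨z, hz, rfl⟩, hzx.symm⟩
  choose y hy hxy using h'
  have hyX : ∀ n, y n ∈ X := fun n => by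
    obtain ⟨z, hz, hzy⟩ := hy n
    rw [← hzy]
    exact compMaps_mapsTo hf _ hz
  refine ⟨y 0, fun n => ?_, hxy 0⟩
  rw [hinj (σ 0) (hyX 0) (hyX n) ((hxy 0).symm.trans (hxy n))]
  exact hy n

theorem exists_isCodedBy {α I : Type*} [TopologicalSpace α] [T2Space α] {f : I → α → α}
    {X : Set α} (hX : IsCompact X) (hne : X.Nonempty) (hf : ∀ i, MapsTo (f i) X X)
    (hc : ∀ i, ContinuousOn (f i) X) (σ : ℕ → I) : ∃ x, IsCodedBy f X σ x := by
  let A : ℕ → Set α := fun n => compMaps f (List.ofFn fun k : Fin n => σ k) '' X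
  have hA : ∀ n, IsCompact (A n) := fun n => hX.image_of_continuousOn (compMaps_continuousOn hf hc _)
  obtain ⟨x, hx⟩ := IsCompact.nonempty_iInter_of_sequence_nonempty_isCompact_isClosed A
    (fun n => by
      have : List.ofFn (fun k : Fin (n + 1) => σ k) =
          List.ofFn (fun k : Fin n => σ k) ++ [σ n] := by
        rw [List.ofFn_succ_last]; simp
      simp only [A, this, compMaps_append, image_comp]
      exact image_mono (compMaps_mapsTo hf _).image_subset)
    (fun n => hne.image _) (hA 0) (fun n => (hA n).isClosed)
  exact ⟨x, fun n => mem_iInter.1 hx n⟩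

/-- A set all of whose points are images of points of the set has codings for all its points. -/
theorem exists_isCodedBy_of_subset_iUnion {α I : Type*} {f : I → α → α} {A X : Set α}
    (hAX : A ⊆ X) (hA : ∀ x ∈ A, ∃ i, ∃ y ∈ A, x = f i y) {x : α} (hx : x ∈ A) :
    ∃ σ, IsCodedBy f X σ x := by
  have h' : ∀ x : A, ∃ i : I, ∃ y : A, (x : α) = f i y := fun x => by
    obtain ⟨i, y, hy, h⟩ := hA x x.2
    exact ⟨i, ⟨y, hy⟩, h⟩
  choose i next hnext using h'
  refine ⟨fun k => i (next^[k] ⟨x, hx⟩), fun n => ⟨(next^[n] ⟨x, hx⟩ : A), hAX (Subtype.coe_prop _), ?_⟩⟩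
  have : ∀ (n : ℕ) (z : A),
      compMaps f (List.ofFn fun k : Fin n => i (next^[k] z)) (next^[n] z : A) = z := by
    intro n
    induction n with
    | zero => intro z; rfl
    | succ n ih =>
      intro z
      rw [List.ofFn_succ]
      simp only [compMaps, Function.comp_apply, Fin.val_zero, Function.iterate_zero, id_eq,
        Fin.val_succ, Function.iterate_succ_apply]
      rw [ih, ← hnext]
  exact this n ⟨x, hx⟩

theorem IsCodedBy.le_dist {α I : Type*} [MetricSpace α] {f : I → α → α} {X : Set α} {a δ : ℝ}
    (ha : 0 < a) (hf : ∀ i, MapsTo (f i) X X) (hinj : ∀ i, InjOn (f i) X)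
    (hanti : ∀ i, ∀ x ∈ X, ∀ y ∈ X, a * dist x y ≤ dist (f i x) (f i y))
    (hsep : ∀ i j, i ≠ j → ∀ x ∈ X, ∀ y ∈ X, δ ≤ dist (f i x) (f j y)) (n : ℕ) :
    ∀ {σ τ : ℕ → I} {x y : α}, IsCodedBy f X σ x → IsCodedBy f X τ y →
      (∀ k < n, σ k = τ k) → σ n ≠ τ n → a ^ n * δ ≤ dist x y := by
  induction n with
  | zero =>
    intro σ τ x y hx hy _ hne
    obtain ⟨x', hx', rfl⟩ := hx.exists_tail hf hinj
    obtain ⟨y', hy', rfl⟩ := hy.exists_tail hf hinj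
    simpa using hsep _ _ hne x' hx'.mem y' hy'.mem
  | succ n ih =>
    intro σ τ x y hx hy heq hne
    obtain ⟨x', hx', rfl⟩ := hx.exists_tail hf hinj
    obtain ⟨y', hy', rfl⟩ := hy.exists_tail hf hinj
    have h1 := ih hx' hy' (fun k hk => heq (k + 1) (by omega)) hne
    rw [← heq 0 (by omega)]
    refine le_trans ?_ (hanti _ x' hx'.mem y' hy'.mem)
    rw [pow_succ', mul_assoc]
    gcongr

/-- Lower bound for the Hausdorff dimension of the attractor of a finite strongly separated
iterated function system whose maps expand distances at worst by the factor `a`. -/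
theorem log_card_div_log_le_dimH {α : Type*} [MetricSpace α] {N : ℕ} {f : Fin N → α → α}
    {X : Set α} {a δ : ℝ} (hX : IsCompact X) (hne : X.Nonempty) (ha : 0 < a) (ha1 : a < 1)
    (hδ : 0 < δ) (hf : ∀ i, MapsTo (f i) X X) (hc : ∀ i, ContinuousOn (f i) X)
    (hanti : ∀ i, ∀ x ∈ X, ∀ y ∈ X, a * dist x y ≤ dist (f i x) (f i y))
    (hsep : ∀ i j, i ≠ j → ∀ x ∈ X, ∀ y ∈ X, δ ≤ dist (f i x) (f j y)) :
    ENNReal.ofReal (Real.log N / Real.log (1 / a)) ≤ dimH {x | ∃ σ, IsCodedBy f X σ x} := by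
  have hinj : ∀ i, InjOn (f i) X := by
    intro i x hx y hy hxy
    have := hanti i x hx y hy
    rw [hxy, dist_self] at this
    have : dist x y ≤ 0 := by nlinarith [dist_nonneg (x := x) (y := y)]
    exact dist_le_zero.1 this
  rcases Nat.lt_or_ge 1 N with hN | hN
  swap
  · have : Real.log N = 0 := by
      interval_cases N <;> simp
    simp [this]
  have hla : 0 < Real.log (1 / a) := Real.log_pos (by rw [lt_div_iff₀ ha]; linarith)
  have hlN : 0 < Real.log N := Real.log_pos (by exact_mod_cast hN)
  set s : ℝ := Real.log N / Real.log (1 / a) with hs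
  have hs0 : 0 < s := by positivity
  have hNa : ((N : ℝ))⁻¹ = a ^ s := by
    have h1 : a = Real.exp (-Real.log (1 / a)) := by
      rw [one_div, Real.log_inv, neg_neg, Real.exp_log ha]
    have h2 : (N : ℝ)⁻¹ = Real.exp (-Real.log N) := by
      rw [Real.exp_neg, Real.exp_log (by positivity)]
    rw [h2]
    nth_rewrite 1 [h1]
    rw [← Real.exp_mul, hs]
    congr 1
    field_simp
  set A : Set α := {x | ∃ σ, IsCodedBy f X σ x} with hA
  have hex : ∀ x, x ∈ A → ∃ σ, IsCodedBy f X σ x := fun x hx => hx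
  classical
  have : Nonempty (ℕ → Fin N) := ⟨fun _ => ⟨0, by omega⟩⟩
  choose! code hcode using hex
  let g : α → ℝ := fun x => Real.ofDigits (code x)
  have hdiff : ∀ σ τ : ℕ → Fin N, σ ≠ τ → ∃ n, (∀ k < n, σ k = τ k) ∧ σ n ≠ τ n := by
    intro σ τ hne
    have : ∃ n, σ n ≠ τ n := Function.ne_iff.1 hne
    refine ⟨Nat.find this, fun k hk => ?_, Nat.find_spec this⟩
    simpa using Nat.find_min this hk
  have himg : Icc (0 : ℝ) 1 ⊆ g '' A := by
    intro t ht
    obtain ⟨σ, -, hσ⟩ := Real.ofDigits_SurjOn hN ht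
    obtain ⟨x, hx⟩ := exists_isCodedBy hX hne hf hc σ
    have hxA : x ∈ A := ⟨σ, hx⟩
    refine ⟨x, hxA, ?_⟩
    have : code x = σ := by
      by_contra h
      obtain ⟨n, hn1, hn2⟩ := hdiff _ _ h
      have := IsCodedBy.le_dist ha hf hinj hanti hsep n (hcode x hxA) hx hn1 hn2
      rw [dist_self] at this
      have : 0 < a ^ n * δ := by positivity
      linarith
    simp only [g, this, hσ]
  have hhol : HolderOnWith (Real.toNNReal ((1 / δ) ^ s)) (Real.toNNReal s) g A := by
    intro x hx y hy
    rw [edist_dist, edist_dist, Real.coe_toNNReal _ hs0.le,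
      ENNReal.ofReal_rpow_of_nonneg dist_nonneg hs0.le,
      ← ENNReal.ofReal, ← ENNReal.ofReal_mul (by positivity)]
    refine ENNReal.ofReal_le_ofReal ?_
    by_cases h : code x = code y
    · simp only [g, h, dist_self]
      positivity
    · obtain ⟨n, hn1, hn2⟩ := hdiff _ _ h
      have h1 := IsCodedBy.le_dist ha hf hinj hanti hsep n (hcode x hx) (hcode y hy) hn1 hn2
      have h2 := Real.abs_ofDigits_sub_ofDigits_le hn1
      rw [Real.dist_eq]
      refine h2.trans ?_
      rw [← Real.mul_rpow (by positivity) dist_nonneg, ← inv_pow, hNa, ← Real.rpow_mul_natCast ha.le,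
        mul_comm s, Real.rpow_natCast_mul ha.le]
      refine Real.rpow_le_rpow (by positivity) ?_ hs0.le
      rw [div_mul_eq_mul_div, one_mul, le_div_iff₀ hδ]
      exact h1
  have hs' : (0 : NNReal) < Real.toNNReal s := Real.toNNReal_pos.2 hs0
  have h1 : (1 : ENNReal) ≤ dimH A / (Real.toNNReal s : NNReal) := by
    calc (1 : ENNReal) = dimH (Icc (0 : ℝ) 1) := by
          rw [Real.dimH_of_nonempty_interior] <;> simp
      _ ≤ dimH (g '' A) := dimH_mono himg
      _ ≤ _ := hhol.dimH_image_le hs'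
  rw [ENNReal.le_div_iff_mul_le (by simp [hs0]) (by simp), one_mul] at h1
  exact h1

namespace CIFS
variable {d : ℕ} (Φ : CIFS d)

theorem injOn_S (i : Φ.I) : InjOn (Φ.S i) Φ.X := by
  intro x hx y hy hxy
  by_contra hne
  have := (Φ.hcontr i x hx y hy).1 hne
  rw [hxy, dist_self] at this
  exact lt_irrefl _ this

theorem continuousOn_S (i : Φ.I) : ContinuousOn (Φ.S i) Φ.X := by
  have : LipschitzOnWith (Real.toNNReal Φ.c) (Φ.S i) Φ.X :=
    LipschitzOnWith.of_dist_le_mul fun x hx y hy => by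
      rw [Real.coe_toNNReal _ Φ.hc0.le]
      exact (Φ.hcontr i x hx y hy).2
  exact this.continuousOn

theorem compMaps_T_eq (w : List Φ.I) {x : EuclideanSpace ℝ (Fin d)} (hx : x ∈ Φ.X) :
    compMaps Φ.T w x = compMaps Φ.S w x := by
  induction w with
  | nil => rfl
  | cons i w ih =>
    simp only [compMaps, Function.comp_apply, ih]
    exact Φ.hTagree i _ (compMaps_mapsTo Φ.hSmaps w hx)

theorem differentiableAt_T (i : Φ.I) {x : EuclideanSpace ℝ (Fin d)} (hx : x ∈ Φ.V) :
    DifferentiableAt ℝ (Φ.T i) x :=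
  ((Φ.hTdiff i).differentiableOn one_ne_zero).differentiableAt (Φ.hVopen.mem_nhds hx)

theorem differentiableAt_compMaps (w : List Φ.I) {x : EuclideanSpace ℝ (Fin d)} (hx : x ∈ Φ.V) :
    DifferentiableAt ℝ (compMaps Φ.T w) x := by
  induction w with
  | nil => exact differentiableAt_id
  | cons i w ih => exact (Φ.differentiableAt_T i (compMaps_mapsTo Φ.hTmaps w hx)).comp x ih

theorem isConformalMap_compMaps (w : List Φ.I) {x : EuclideanSpace ℝ (Fin d)} (hx : x ∈ Φ.V) :
    IsConformalMap (fderiv ℝ (compMaps Φ.T w) x) := by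
  induction w with
  | nil =>
    rw [compMaps, fderiv_id]
    exact isConformalMap_id
  | cons i w ih =>
    have hw := compMaps_mapsTo Φ.hTmaps w hx
    rw [compMaps, fderiv_comp x (Φ.differentiableAt_T i hw) (Φ.differentiableAt_compMaps w hx)]
    exact (Φ.hTconf i _ hw).comp ih

/-- A conformal map scales all norms by its operator norm. -/
theorem _root_.IsConformalMap.norm_apply_eq {E : Type*} [NormedAddCommGroup E] [NormedSpace ℝ E]
    [Nontrivial E] {L : E →L[ℝ] E} (hL : IsConformalMap L) (v : E) : ‖L v‖ = ‖L‖ * ‖v‖ := by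
  obtain ⟨c, -, li, rfl⟩ := hL
  rw [norm_smul, LinearIsometry.norm_toContinuousLinearMap, mul_one]
  simp [norm_smul]

theorem _root_.IsConformalMap.norm_pos {E : Type*} [NormedAddCommGroup E] [NormedSpace ℝ E]
    [Nontrivial E] {L : E →L[ℝ] E} (hL : IsConformalMap L) : 0 < ‖L‖ := by
  obtain ⟨c, hc, li, rfl⟩ := hL
  rw [norm_smul, LinearIsometry.norm_toContinuousLinearMap, mul_one]
  exact norm_pos_iff.2 hc

/-- A base point in the interior of the seed set. -/
def basePt : EuclideanSpace ℝ (Fin d) := Φ.hXint.some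

theorem basePt_mem_interior : Φ.basePt ∈ interior Φ.X := Φ.hXint.some_mem

theorem basePt_mem : Φ.basePt ∈ Φ.X := interior_subset Φ.basePt_mem_interior

theorem basePt_mem_V : Φ.basePt ∈ Φ.V := Φ.hXV Φ.basePt_mem

/-- The contraction ratio of the map indexed by `w` at the base point. -/
def ratio (w : List Φ.I) : ℝ := ‖fderiv ℝ (compMaps Φ.T w) Φ.basePt‖

theorem dist_compMaps_S_le (w : List Φ.I) {x y : EuclideanSpace ℝ (Fin d)} (hx : x ∈ Φ.X)
    (hy : y ∈ Φ.X) :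
    dist (compMaps Φ.S w x) (compMaps Φ.S w y) ≤ Φ.c ^ w.length * dist x y := by
  induction w with
  | nil => simp [compMaps]
  | cons i w ih =>
    simp only [compMaps, Function.comp_apply, List.length_cons]
    refine ((Φ.hcontr i _ (compMaps_mapsTo Φ.hSmaps w hx) _
      (compMaps_mapsTo Φ.hSmaps w hy)).2).trans ?_
    rw [pow_succ', mul_assoc]
    exact mul_le_mul_of_nonneg_left ih Φ.hc0.le

theorem ratio_le_pow (w : List Φ.I) : Φ.ratio w ≤ Φ.c ^ w.length := by
  have h : LipschitzOnWith (Real.toNNReal (Φ.c ^ w.length)) (compMaps Φ.T w) Φ.X :=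
    LipschitzOnWith.of_dist_le_mul fun x hx y hy => by
      rw [Real.coe_toNNReal _ (pow_nonneg Φ.hc0.le _), Φ.compMaps_T_eq w hx, Φ.compMaps_T_eq w hy]
      exact Φ.dist_compMaps_S_le w hx hy
  have := norm_fderiv_le_of_lipschitzOn ℝ
    (mem_of_superset (isOpen_interior.mem_nhds Φ.basePt_mem_interior) interior_subset) h
  rwa [Real.coe_toNNReal _ (pow_nonneg Φ.hc0.le _)] at this

theorem ratio_le_one (w : List Φ.I) : Φ.ratio w ≤ 1 :=
  (Φ.ratio_le_pow w).trans (pow_le_one₀ Φ.hc0.le Φ.hc1.le)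

theorem exists_dist_le : ∃ C : ℝ, 0 < C ∧ ∀ w : List Φ.I, ∀ x ∈ Φ.X, ∀ y ∈ Φ.X,
    dist (compMaps Φ.S w x) (compMaps Φ.S w y) ≤ C * Φ.ratio w * dist x y := by
  obtain ⟨C, hC, h⟩ := exists_dist_le_of_norm_fderiv_le Φ.hXcompact Φ.hXconn Φ.hVopen Φ.hXV
  have hK := Φ.hK
  refine ⟨C * Φ.K, by positivity, fun w x hx y hy => ?_⟩
  have := h (compMaps Φ.T w) (Φ.K * Φ.ratio w) (fun z hz => Φ.differentiableAt_compMaps w hz)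
    (fun z hz => Φ.hBD w z hz _ Φ.basePt_mem_V) x hx y hy
  rwa [Φ.compMaps_T_eq w hx, Φ.compMaps_T_eq w hy, ← mul_assoc] at this

theorem disjoint_compMaps_image {u v : List Φ.I} (hlen : u.length = v.length) (hne : u ≠ v) :
    Disjoint (compMaps Φ.S u '' interior Φ.X) (compMaps Φ.S v '' interior Φ.X) := by
  have hmaps : ∀ i, MapsTo (Φ.S i) (interior Φ.X) (interior Φ.X) :=
    fun i => mapsTo_iff_image_subset.2 (Φ.hOSCin i)
  induction u generalizing v with
  | nil =>
    cases v with
    | nil => exact absurd rfl hne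
    | cons j v => simp at hlen
  | cons i u ih =>
    cases v with
    | nil => simp at hlen
    | cons j v =>
      simp only [compMaps, image_comp]
      have hu : compMaps Φ.S u '' interior Φ.X ⊆ interior Φ.X := (compMaps_mapsTo hmaps u).image_subset
      have hv : compMaps Φ.S v '' interior Φ.X ⊆ interior Φ.X := (compMaps_mapsTo hmaps v).image_subset
      by_cases hij : i = j
      · subst hij
        have huv : u ≠ v := fun h => hne (by rw [h])
        rw [Set.disjoint_left]
        rintro _ ⟨x, hx, rfl⟩ ⟨y, hy, hyx⟩
        rw [Φ.injOn_S i (interior_subset (hv hy)) (interior_subset (hu hx)) hyx] at hy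
        exact (Set.disjoint_left.1 (ih (by simpa using hlen) huv)) hx hy
      · exact (Φ.hOSCdisj i j hij).mono (image_mono hu) (image_mono hv)

variable [Nontrivial (EuclideanSpace ℝ (Fin d))]

theorem ratio_pos (w : List Φ.I) : 0 < Φ.ratio w :=
  (Φ.isConformalMap_compMaps w Φ.basePt_mem_V).norm_pos

theorem ratio_nil : Φ.ratio [] = 1 := by
  rw [ratio, compMaps, fderiv_id]
  exact ContinuousLinearMap.norm_id

theorem ratio_div_mul_norm_le (w : List Φ.I) {z : EuclideanSpace ℝ (Fin d)} (hz : z ∈ Φ.V)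
    (v : EuclideanSpace ℝ (Fin d)) :
    Φ.ratio w / Φ.K * ‖v‖ ≤ ‖fderiv ℝ (compMaps Φ.T w) z v‖ := by
  rw [(Φ.isConformalMap_compMaps w hz).norm_apply_eq]
  have hK : 0 < Φ.K := by linarith [Φ.hK]
  gcongr
  rw [div_le_iff₀ hK, mul_comm]
  exact Φ.hBD w _ Φ.basePt_mem_V _ hz

theorem exists_le_dist : ∃ a : ℝ, 0 < a ∧ a ≤ 1 ∧ ∀ w : List Φ.I, ∀ x ∈ Φ.X, ∀ y ∈ Φ.X,
    a * Φ.ratio w * dist x y ≤ dist (compMaps Φ.S w x) (compMaps Φ.S w y) := by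
  obtain ⟨δ, hδ, hδV⟩ := Φ.hXcompact.exists_cthickening_subset_open Φ.hVopen Φ.hXV
  have hK := Φ.hK
  have hD : 0 ≤ diam Φ.X := diam_nonneg
  refine ⟨min (1 / (2 * Φ.K)) (δ / (2 * Φ.K * (diam Φ.X + 1))), by positivity, ?_, ?_⟩
  · refine (min_le_left _ _).trans ?_
    rw [div_le_one (by positivity)]
    linarith
  intro w x hx y hy
  have hρ := Φ.ratio_pos w
  have hb : closedBall x δ ⊆ Φ.V := (closedBall_subset_cthickening hx δ).trans hδV
  rw [← Φ.compMaps_T_eq w hx, ← Φ.compMaps_T_eq w hy]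
  rcases lt_or_ge (dist (compMaps Φ.T w y) (compMaps Φ.T w x)) (Φ.ratio w / Φ.K / 2 * δ)
    with h | h
  · obtain ⟨z, hz, hfz, hd⟩ := exists_preimage_of_expanding_fderiv hδ (m := Φ.ratio w / Φ.K)
      (by positivity) (fun z hz => Φ.differentiableAt_compMaps w (hb hz))
      (fun z hz => Φ.ratio_div_mul_norm_le w (hb hz)) h
    have hzy : z = y := compMaps_injOn Φ.hTmaps Φ.hTinj w (hb hz) (Φ.hXV hy) hfz
    rw [hzy, dist_comm y, dist_comm (compMaps Φ.T w y)] at hd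
    refine le_trans ?_ hd
    calc _ ≤ 1 / (2 * Φ.K) * Φ.ratio w * dist x y := by gcongr; exact min_le_left _ _
      _ = _ := by field_simp
  · rw [dist_comm (compMaps Φ.T w y)] at h
    refine le_trans ?_ h
    calc _ ≤ δ / (2 * Φ.K * (diam Φ.X + 1)) * Φ.ratio w * (diam Φ.X + 1) := by
          gcongr
          · exact min_le_right _ _
          · linarith [dist_le_diam_of_mem Φ.hXcompact.isBounded hx hy]
      _ = _ := by field_simp

theorem exists_ball_subset_image : ∃ b : ℝ, 0 < b ∧ ∀ w : List Φ.I,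
    ball (compMaps Φ.S w Φ.basePt) (b * Φ.ratio w) ⊆ compMaps Φ.S w '' interior Φ.X := by
  obtain ⟨η, hη, hηX⟩ := nhds_basis_closedBall.mem_iff.1
    (isOpen_interior.mem_nhds Φ.basePt_mem_interior)
  have hK := Φ.hK
  refine ⟨η / (2 * Φ.K), by positivity, fun w q hq => ?_⟩
  have hρ := Φ.ratio_pos w
  have hb : closedBall Φ.basePt η ⊆ Φ.V := (hηX.trans interior_subset).trans Φ.hXV
  obtain ⟨z, hz, hfz, -⟩ := exists_preimage_of_expanding_fderiv hη (m := Φ.ratio w / Φ.K)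
    (q := q) (by positivity) (fun z hz => Φ.differentiableAt_compMaps w (hb hz))
    (fun z hz => Φ.ratio_div_mul_norm_le w (hb hz)) (by
      rw [Φ.compMaps_T_eq w Φ.basePt_mem]
      refine (mem_ball.1 hq).trans_eq ?_
      field_simp)
  exact ⟨z, hηX hz, by rw [← Φ.compMaps_T_eq w (interior_subset (hηX hz)), hfz]⟩

end CIFS

namespace CIFS
variable {d : ℕ} (Φ : CIFS d)

theorem mem_limitSet_iff {x : EuclideanSpace ℝ (Fin d)} :
    x ∈ Φ.limitSet ↔ ∃ γ, IsCodedBy Φ.S Φ.X γ x := by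
  simp only [limitSet, mem_iUnion, mem_iInter]
  refine exists_congr fun γ => ⟨fun h n => ?_, fun h n => h (n + 1)⟩
  cases n with
  | succ n => exact h n
  | zero =>
    obtain ⟨z, hz, hzx⟩ := h 0
    exact ⟨x, hzx ▸ compMaps_mapsTo Φ.hSmaps _ hz, rfl⟩

theorem limitSet_subset : Φ.limitSet ⊆ Φ.X := fun _ hx => by
  obtain ⟨γ, hγ⟩ := Φ.mem_limitSet_iff.1 hx
  exact hγ.mem

theorem subset_limitSet {A : Set (EuclideanSpace ℝ (Fin d))} (hAX : A ⊆ Φ.X)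
    (hA : ∀ x ∈ A, ∃ i, ∃ y ∈ A, x = Φ.S i y) : A ⊆ Φ.limitSet := fun _ hx =>
  Φ.mem_limitSet_iff.2 (exists_isCodedBy_of_subset_iUnion hAX hA hx)

theorem fixedPoints_subset_limitSet : Φ.fixedPoints ⊆ Φ.limitSet :=
  Φ.subset_limitSet (fun _ hx => hx.1) fun x hx => by
    obtain ⟨i, hi⟩ := hx.2
    exact ⟨i, x, hx, hi.symm⟩

theorem exists_fixedPoint (i : Φ.I) : ∃ z ∈ Φ.X, Φ.S i z = z := by
  obtain ⟨m, hm, hmin⟩ := Φ.hXcompact.exists_isMinOn Φ.hXconn.nonempty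
    (f := fun x => dist x (Φ.S i x)) (by have := Φ.continuousOn_S i; fun_prop)
  refine ⟨m, hm, ?_⟩
  have h1 := isMinOn_iff.1 hmin _ (Φ.hSmaps i hm)
  have h2 := (Φ.hcontr i m hm _ (Φ.hSmaps i hm)).2
  have h3 := Φ.hc1
  have h4 : dist m (Φ.S i m) ≤ 0 := by
    nlinarith [dist_nonneg (x := m) (y := Φ.S i m)]
  exact (dist_le_zero.1 h4).symm

theorem fixedPoints_nonempty : Φ.fixedPoints.Nonempty := by
  obtain ⟨z, hz, hfz⟩ := Φ.exists_fixedPoint Φ.hInonempty.some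
  exact ⟨z, hz, _, hfz⟩

/-- The attractor of any system of nonempty words is contained in the limit set. -/
theorem isCodedBy_compMaps_mem_limitSet {N : Type*} (w : N → List Φ.I) (hw : ∀ i, w i ≠ []) :
    {x | ∃ σ, IsCodedBy (fun i => compMaps Φ.S (w i)) Φ.X σ x} ⊆ Φ.limitSet := by
  set A := {x | ∃ σ, IsCodedBy (fun i => compMaps Φ.S (w i)) Φ.X σ x} with hA
  have hAX : A ⊆ Φ.X := fun x ⟨σ, hσ⟩ => hσ.mem
  have hstep : ∀ x ∈ A, ∃ i, ∃ y ∈ A, x = compMaps Φ.S (w i) y := by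
    rintro x ⟨σ, hσ⟩
    obtain ⟨y, hy, hxy⟩ := hσ.exists_tail (fun i => compMaps_mapsTo Φ.hSmaps (w i))
      (fun i => compMaps_injOn Φ.hSmaps Φ.injOn_S (w i))
    exact ⟨σ 0, y, ⟨_, hy⟩, hxy⟩
  let B := {x | ∃ v : List Φ.I, ∃ y ∈ A, x = compMaps Φ.S v y}
  have hAB : A ⊆ B := fun x hx => ⟨[], x, hx, rfl⟩
  refine hAB.trans (Φ.subset_limitSet ?_ ?_)
  · rintro x ⟨v, y, hy, rfl⟩
    exact compMaps_mapsTo Φ.hSmaps v (hAX hy)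
  · rintro x ⟨v, y, hy, rfl⟩
    cases v with
    | cons i v => exact ⟨i, _, ⟨v, y, hy, rfl⟩, rfl⟩
    | nil =>
      obtain ⟨j, z, hz, rfl⟩ := hstep y hy
      cases hj : w j with
      | nil => exact absurd hj (hw j)
      | cons i u => exact ⟨i, _, ⟨u, z, hz, rfl⟩, rfl⟩

variable [Nontrivial (EuclideanSpace ℝ (Fin d))]

/-- The number of words of a given length with ratio of order `exp (-k)` is bounded in terms of
the Hausdorff dimension of the limit set. -/
theorem exists_card_le_exp : ∃ C : ℝ, 0 < C ∧ ∀ (k n : ℕ) (A : Finset (List Φ.I)),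
    (∀ w ∈ A, w.length = n) →
    (∀ w ∈ A, Real.exp (-(k + 1 : ℝ)) < Φ.ratio w ∧ Φ.ratio w ≤ Real.exp (-k)) →
    (A.card : ℝ) ≤ C * Real.exp (k * (dimH Φ.limitSet).toReal) := by
  obtain ⟨C₁, hC₁, hlip⟩ := Φ.exists_dist_le
  obtain ⟨a, ha, ha1, hanti⟩ := Φ.exists_le_dist
  obtain ⟨b, hb, hball⟩ := Φ.exists_ball_subset_image
  set D := diam Φ.X
  have hD : 0 ≤ D := diam_nonneg
  set h := (dimH Φ.limitSet).toReal with hh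
  have hh0 : 0 ≤ h := ENNReal.toReal_nonneg
  set R : ℝ := 2 * C₁ * D + 1 with hR
  have hRpos : 0 < R := by positivity
  obtain ⟨M, hM⟩ := exists_card_le_of_separated (E := EuclideanSpace ℝ (Fin d)) R
    (b := b * Real.exp (-1)) (by positivity)
  refine ⟨1 + M * Real.exp (h * Real.log (Real.exp 1 / a)), by positivity, ?_⟩
  intro k n A hlen hA
  have hE : 1 ≤ Real.exp (k * h) := Real.one_le_exp (by positivity)
  have hC0 : 0 ≤ M * Real.exp (h * Real.log (Real.exp 1 / a)) := by positivity
  rcases Nat.eq_zero_or_pos n with rfl | hn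
  · have : A.card ≤ 1 := Finset.card_le_one.2 fun u hu v hv => by
      rw [List.eq_nil_of_length_eq_zero (hlen u hu), List.eq_nil_of_length_eq_zero (hlen v hv)]
    have : (A.card : ℝ) ≤ 1 := by exact_mod_cast this
    nlinarith
  set s := Real.exp (-k : ℝ) with hs
  have hs0 : 0 < s := Real.exp_pos _
  have hs1 : s ≤ 1 := Real.exp_le_one_iff.2 (by simp)
  have hse : Real.exp (-(k + 1 : ℝ)) = s * Real.exp (-1) := by
    rw [hs, ← Real.exp_add]; ring_nf
  let p : List Φ.I → EuclideanSpace ℝ (Fin d) := fun w => compMaps Φ.S w Φ.basePt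
  have hpsep : ∀ u ∈ A, ∀ v ∈ A, u ≠ v → b * Real.exp (-1) * s ≤ dist (p u) (p v) := by
    intro u hu v hv huv
    have hdis := Φ.disjoint_compMaps_image ((hlen u hu).trans (hlen v hv).symm) huv
    have hv' : p v ∉ ball (p u) (b * Φ.ratio u) := fun hmem =>
      Set.disjoint_left.1 hdis (hball u hmem) ⟨_, Φ.basePt_mem_interior, rfl⟩
    rw [mem_ball', not_lt] at hv'
    refine le_trans ?_ hv'
    have := (hA u hu).1
    rw [hse] at this
    nlinarith
  obtain ⟨B, hBA, hcard, hind⟩ := Finset.exists_independent_subset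
    (fun u v => dist (p u) (p v) < R * s) M (fun u => by rw [dist_self]; positivity)
    (fun u v huv => by rwa [dist_comm]) A (fun i hi t ht hti =>
      hM _ t p (p i) s hs0 (fun j hj => (hti j hj).le)
        (fun u hu v hv => hpsep u (ht hu) v (ht hv)))
  let e := B.equivFin
  let w : Fin B.card → List Φ.I := fun i => (e.symm i : List Φ.I)
  have hwB : ∀ i, w i ∈ B := fun i => (e.symm i).2
  have hwinj : ∀ i j, i ≠ j → w i ≠ w j := fun i j hij h =>
    hij (e.symm.injective (Subtype.ext h))
  have ha' : a * (s * Real.exp (-1)) < 1 := by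
    have h1 : Real.exp (-1 : ℝ) < 1 := Real.exp_lt_one_iff.2 (by norm_num)
    have h2 : 0 < Real.exp (-1 : ℝ) := Real.exp_pos _
    have h3 : s * Real.exp (-1) < 1 := by nlinarith
    nlinarith
  have hdim := log_card_div_log_le_dimH (f := fun i => compMaps Φ.S (w i)) (X := Φ.X)
    (a := a * (s * Real.exp (-1))) (δ := s) Φ.hXcompact Φ.hXconn.nonempty (by positivity) ha' hs0
    (fun i => compMaps_mapsTo Φ.hSmaps (w i))
    (fun i => compMaps_continuousOn Φ.hSmaps Φ.continuousOn_S (w i))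
    (fun i x hx y hy => by
      refine le_trans ?_ (hanti (w i) x hx y hy)
      gcongr
      rw [← hse]
      exact (hA _ (hBA (hwB i))).1.le)
    (fun i j hij x hx y hy => by
      have h1 := hind _ (hwB i) _ (hwB j) (hwinj i j hij)
      rw [not_lt] at h1
      have hX : ∀ i, ∀ x ∈ Φ.X, dist (p (w i)) (compMaps Φ.S (w i) x) ≤ C₁ * s * D := by
        intro i x hx
        refine (hlip (w i) _ Φ.basePt_mem x hx).trans ?_
        have h2 := (hA _ (hBA (hwB i))).2
        have h3 := dist_le_diam_of_mem Φ.hXcompact.isBounded Φ.basePt_mem hx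
        have h4 := Φ.ratio_pos (w i)
        gcongr
      have h2 := hX i x hx
      have h3 := hX j y hy
      have h4 := dist_triangle4 (p (w i)) (compMaps Φ.S (w i) x) (compMaps Φ.S (w j) y) (p (w j))
      rw [dist_comm (compMaps Φ.S (w j) y) (p (w j))] at h4
      have h5 : R * s = C₁ * s * D + s + C₁ * s * D := by rw [hR]; ring
      linarith)
  have hdim' := hdim.trans (dimH_mono (Φ.isCodedBy_compMaps_mem_limitSet w (fun i hi => by
    have := hlen _ (hBA (hwB i))
    rw [hi] at this
    simp at this
    omega)))
  have hle : Real.log B.card / Real.log (1 / (a * (s * Real.exp (-1)))) ≤ h :=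
    (ENNReal.ofReal_le_iff_le_toReal (Real.dimH_ne_top _)).1 hdim'
  have hlogpos : 0 < Real.log (1 / (a * (s * Real.exp (-1)))) :=
    Real.log_pos (by rw [lt_div_iff₀ (by positivity)]; linarith)
  rw [div_le_iff₀ hlogpos] at hle
  have hlogeq : Real.log (1 / (a * (s * Real.exp (-1)))) = Real.log (Real.exp 1 / a) + k := by
    rw [Real.log_div one_ne_zero (by positivity), Real.log_mul ha.ne' (by positivity),
      Real.log_mul hs0.ne' (by positivity), Real.log_div (by positivity) ha.ne', Real.log_exp,
      Real.log_exp, Real.log_exp, Real.log_one]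
    ring
  have hBle : (B.card : ℝ) ≤ Real.exp (h * Real.log (Real.exp 1 / a)) * Real.exp (k * h) := by
    rw [← Real.exp_add]
    refine (Real.le_exp_log _).trans (Real.exp_le_exp.2 (hle.trans_eq ?_))
    rw [hlogeq]; ring
  have hcard' : (A.card : ℝ) ≤ M * B.card := by exact_mod_cast hcard
  calc (A.card : ℝ) ≤ M * B.card := hcard'
    _ ≤ M * (Real.exp (h * Real.log (Real.exp 1 / a)) * Real.exp (k * h)) := by gcongr
    _ ≤ _ := by nlinarith

/-- The total ratio sum over all finite words converges for every exponent larger than the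
Hausdorff dimension of the limit set. -/
theorem summable_ratio_rpow {t : ℝ} (ht : (dimH Φ.limitSet).toReal < t) :
    Summable fun w : List Φ.I => Φ.ratio w ^ t := by
  obtain ⟨C, hC, hcount⟩ := Φ.exists_card_le_exp
  set h := (dimH Φ.limitSet).toReal
  have hh0 : 0 ≤ h := ENNReal.toReal_nonneg
  obtain ⟨t', ht1, ht2⟩ := exists_between ht
  set q₁ := Φ.c ^ (t - t') with hq₁
  set q₂ := Real.exp (h - t') with hq₂
  have hq₁0 : 0 < q₁ := Real.rpow_pos_of_pos Φ.hc0 _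
  have hq₁1 : q₁ < 1 := Real.rpow_lt_one Φ.hc0.le Φ.hc1 (by linarith)
  have hq₂0 : 0 < q₂ := Real.exp_pos _
  have hq₂1 : q₂ < 1 := Real.exp_lt_one_iff.2 (by linarith)
  have hsum : Summable fun x : ℕ × ℕ => C * (q₁ ^ x.1 * q₂ ^ x.2) :=
    ((summable_geometric_of_lt_one hq₁0.le hq₁1).mul_of_nonneg
      (summable_geometric_of_lt_one hq₂0.le hq₂1) (fun n => by positivity)
      (fun n => by positivity)).mul_left C
  refine summable_of_sum_le (c := ∑' x : ℕ × ℕ, C * (q₁ ^ x.1 * q₂ ^ x.2))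
    (fun w => Real.rpow_nonneg (Φ.ratio_pos w).le _) fun A => ?_
  classical
  let φ : List Φ.I → ℕ × ℕ := fun w => (w.length, ⌊-Real.log (Φ.ratio w)⌋₊)
  have hk : ∀ w, Real.exp (-((φ w).2 + 1 : ℝ)) < Φ.ratio w ∧
      Φ.ratio w ≤ Real.exp (-((φ w).2 : ℝ)) := by
    intro w
    have hp := Φ.ratio_pos w
    have h0 : 0 ≤ -Real.log (Φ.ratio w) := by
      linarith [Real.log_nonpos hp.le (Φ.ratio_le_one w)]
    constructor
    · rw [← Real.lt_log_iff_exp_lt hp]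
      linarith [Nat.lt_floor_add_one (-Real.log (Φ.ratio w))]
    · rw [← Real.log_le_iff_le_exp hp]
      linarith [Nat.floor_le h0]
  rw [← Finset.sum_fiberwise_of_maps_to (t := A.image φ) (g := φ)
    (fun w hw => Finset.mem_image_of_mem φ hw)]
  refine le_trans (Finset.sum_le_sum fun x _ => ?_)
    (hsum.sum_le_tsum (A.image φ) fun x _ => by positivity)
  have hterm : ∀ w ∈ A.filter (fun w => φ w = x),
      Φ.ratio w ^ t ≤ q₁ ^ x.1 * Real.exp (-(x.2 : ℝ) * t') := by
    intro w hw
    have hwx := (Finset.mem_filter.1 hw).2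
    have hp := Φ.ratio_pos w
    have h1 : Φ.ratio w ^ (t - t') ≤ q₁ ^ x.1 := by
      rw [hq₁, ← Real.rpow_mul_natCast Φ.hc0.le, mul_comm, Real.rpow_natCast_mul Φ.hc0.le, ← hwx]
      exact Real.rpow_le_rpow hp.le (Φ.ratio_le_pow w) (by linarith)
    have h2 : Φ.ratio w ^ t' ≤ Real.exp (-(x.2 : ℝ) * t') := by
      rw [Real.exp_mul, ← hwx]
      exact Real.rpow_le_rpow hp.le (hk w).2 (by linarith)
    calc Φ.ratio w ^ t = Φ.ratio w ^ (t - t') * Φ.ratio w ^ t' := by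
          rw [← Real.rpow_add hp]; ring_nf
      _ ≤ _ := by
          gcongr
  refine (Finset.sum_le_card_nsmul _ _ _ hterm).trans ?_
  rw [nsmul_eq_mul]
  have hc := hcount x.2 x.1 (A.filter (fun w => φ w = x))
    (fun w hw => congrArg Prod.fst (Finset.mem_filter.1 hw).2)
    (fun w hw => by
      have := hk w
      rwa [(Finset.mem_filter.1 hw).2] at this)
  calc _ ≤ (C * Real.exp (x.2 * h)) * (q₁ ^ x.1 * Real.exp (-(x.2 : ℝ) * t')) := by
        gcongr
    _ = C * (q₁ ^ x.1 * (Real.exp (x.2 * h) * Real.exp (-(x.2 : ℝ) * t'))) := by ring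
    _ = _ := by
        rw [← Real.exp_add, hq₂, ← Real.exp_nat_mul]
        ring_nf

end CIFS

theorem coveringNumber_le_card {α : Type*} [PseudoMetricSpace α] {A : Set α} {r : ℝ}
    (t : Finset α) (h : A ⊆ ⋃ x ∈ t, ball x r) : _root_.coveringNumber A r ≤ t.card :=
  Nat.sInf_le ⟨t, rfl, h⟩

theorem exists_card_eq_coveringNumber {α : Type*} [PseudoMetricSpace α] {A : Set α} {r : ℝ}
    (hA : TotallyBounded A) (hr : 0 < r) :
    ∃ t : Finset α, t.card = _root_.coveringNumber A r ∧ A ⊆ ⋃ x ∈ t, ball x r := by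
  obtain ⟨t, ht, hAt⟩ := Metric.totallyBounded_iff.1 hA r hr
  exact Nat.sInf_mem (s := {n : ℕ | ∃ t : Finset α, t.card = n ∧ A ⊆ ⋃ x ∈ t, ball x r})
    ⟨_, ht.toFinset, rfl, by simpa using hAt⟩

theorem coveringNumber_mono {α : Type*} [PseudoMetricSpace α] {A B : Set α} {r : ℝ}
    (hB : TotallyBounded B) (hAB : A ⊆ B) (hr : 0 < r) :
    _root_.coveringNumber A r ≤ _root_.coveringNumber B r := by
  obtain ⟨t, ht, hBt⟩ := exists_card_eq_coveringNumber hB hr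
  exact ht ▸ coveringNumber_le_card t (hAB.trans hBt)

theorem coveringNumber_anti {α : Type*} [PseudoMetricSpace α] {A : Set α} {r s : ℝ}
    (hA : TotallyBounded A) (hr : 0 < r) (hrs : r ≤ s) :
    _root_.coveringNumber A s ≤ _root_.coveringNumber A r := by
  obtain ⟨t, ht, hAt⟩ := exists_card_eq_coveringNumber hA hr
  exact ht ▸ coveringNumber_le_card t (hAt.trans (iUnion₂_mono fun x _ => ball_subset_ball hrs))

theorem coveringNumber_pos {α : Type*} [PseudoMetricSpace α] {A : Set α} {r : ℝ}
    (hA : TotallyBounded A) (hne : A.Nonempty) (hr : 0 < r) : 0 < _root_.coveringNumber A r := by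
  obtain ⟨t, ht, hAt⟩ := exists_card_eq_coveringNumber hA hr
  obtain ⟨x, hx⟩ := hne
  obtain ⟨y, hy, -⟩ := mem_iUnion₂.1 (hAt hx)
  exact ht ▸ Finset.card_pos.2 ⟨y, hy⟩

/-- A cover whose centers lie in the covered set, at the cost of doubling the radius. -/
theorem exists_subset_card_le_coveringNumber {α : Type*} [PseudoMetricSpace α] {A : Set α} {r : ℝ}
    (hA : TotallyBounded A) (hne : A.Nonempty) (hr : 0 < r) :
    ∃ t : Finset α, t.card ≤ _root_.coveringNumber A r ∧ (∀ x ∈ t, x ∈ A) ∧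
      ∀ x ∈ A, ∃ y ∈ t, dist x y ≤ 2 * r := by
  classical
  obtain ⟨t, ht, hAt⟩ := exists_card_eq_coveringNumber hA hr
  have hch : ∀ q, ∃ y ∈ A, (ball q r ∩ A).Nonempty → dist y q < r := by
    intro q
    by_cases hq : (ball q r ∩ A).Nonempty
    · obtain ⟨y, hy, hyA⟩ := hq
      exact ⟨y, hyA, fun _ => hy⟩
    · exact ⟨hne.some, hne.some_mem, fun h => absurd h hq⟩
  choose f hfA hf using hch
  refine ⟨t.image f, ht ▸ Finset.card_image_le, ?_, ?_⟩
  · intro x hx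
    obtain ⟨q, -, rfl⟩ := Finset.mem_image.1 hx
    exact hfA q
  · intro x hx
    obtain ⟨q, hq, hxq⟩ := mem_iUnion₂.1 (hAt hx)
    have h1 := hf q ⟨x, hxq, hx⟩
    refine ⟨f q, Finset.mem_image_of_mem f hq, ?_⟩
    have h2 := dist_triangle_right x (f q) q
    rw [mem_ball] at hxq
    linarith

theorem exists_coveringNumber_le_pow {E : Type*} [NormedAddCommGroup E] [NormedSpace ℝ E]
    [FiniteDimensional ℝ E] {A : Set E} (hA : TotallyBounded A) :
    ∃ (C : ℝ) (n : ℕ), ∀ r : ℝ, 0 < r → r < 1 →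
      (_root_.coveringNumber A r : ℝ) ≤ C * (1 / r) ^ n := by
  classical
  have : ProperSpace E := FiniteDimensional.proper_real E
  obtain ⟨T, hT⟩ : ∃ T : Finset E, ball (0 : E) 1 ⊆ ⋃ x ∈ T, ball x (1 / 2) := by
    obtain ⟨t, ht, hAt⟩ := Metric.totallyBounded_iff.1
      ((isCompact_closedBall (0 : E) 1).totallyBounded.subset ball_subset_closedBall)
      (1 / 2) (by norm_num)
    exact ⟨ht.toFinset, by simpa using hAt⟩
  have hhalf : ∀ r : ℝ, 0 < r →
      _root_.coveringNumber A (r / 2) ≤ T.card * _root_.coveringNumber A r := by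
    intro r hr
    obtain ⟨t, ht, hAt⟩ := exists_card_eq_coveringNumber hA hr
    refine (coveringNumber_le_card ((T ×ˢ t).image fun p => p.2 + r • p.1) ?_).trans
      (Finset.card_image_le.trans (by rw [Finset.card_product, ht]))
    intro x hx
    obtain ⟨q, hq, hxq⟩ := mem_iUnion₂.1 (hAt hx)
    have h1 : r⁻¹ • (x - q) ∈ ball (0 : E) 1 := by
      rw [mem_ball_zero_iff, norm_smul, norm_inv, Real.norm_of_nonneg hr.le, inv_mul_lt_iff₀ hr,
        mul_one, ← dist_eq_norm]
      exact hxq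
    obtain ⟨u, hu, hxu⟩ := mem_iUnion₂.1 (hT h1)
    refine mem_iUnion₂.2 ⟨q + r • u, Finset.mem_image.2 ⟨(u, q), by simp [hu, hq], rfl⟩, ?_⟩
    rw [mem_ball, dist_eq_norm] at hxu ⊢
    have h2 : x - (q + r • u) = r • (r⁻¹ • (x - q) - u) := by
      rw [smul_sub, smul_inv_smul₀ hr.ne']; abel
    rw [h2, norm_smul, Real.norm_of_nonneg hr.le]
    nlinarith
  have hiter : ∀ k : ℕ, _root_.coveringNumber A ((1 / 2) ^ k) ≤
      T.card ^ k * _root_.coveringNumber A 1 := by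
    intro k
    induction k with
    | zero => simp
    | succ k ih =>
      have := hhalf ((1 / 2) ^ k) (by positivity)
      rw [pow_succ (1 / 2 : ℝ), ← div_eq_mul_one_div]
      exact this.trans ((Nat.mul_le_mul_left _ ih).trans_eq (by ring))
  refine ⟨2 ^ T.card * _root_.coveringNumber A 1, T.card, fun r hr hr1 => ?_⟩
  obtain ⟨k, hk, hk'⟩ := exists_nat_pow_near (x := 1 / r) (y := 2)
    (by rw [le_div_iff₀ hr]; linarith) (by norm_num)
  have h1 : ((1 : ℝ) / 2) ^ (k + 1) ≤ r := by
    rw [one_div_pow, div_le_iff₀ (by positivity)]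
    rw [div_lt_iff₀ hr] at hk'
    linarith
  have h2 := (coveringNumber_anti hA (by positivity) h1).trans (hiter (k + 1))
  have h3 : T.card ^ (k + 1) ≤ (2 ^ T.card) ^ (k + 1) := Nat.pow_le_pow_left Nat.lt_two_pow_self.le _
  have h4 : (_root_.coveringNumber A r : ℝ) ≤
      (2 ^ T.card) ^ (k + 1) * _root_.coveringNumber A 1 := by
    exact_mod_cast h2.trans (Nat.mul_le_mul_right _ h3)
  refine h4.trans ?_
  have h5 : ((2 : ℝ) ^ T.card) ^ (k + 1) = 2 ^ T.card * (2 ^ k) ^ T.card := by ring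
  rw [h5]
  have h6 : ((2 : ℝ) ^ k) ^ T.card ≤ (1 / r) ^ T.card := pow_le_pow_left₀ (by positivity) hk _
  calc _ ≤ (2 : ℝ) ^ T.card * (1 / r) ^ T.card * _root_.coveringNumber A 1 := by gcongr
    _ = _ := by ring

theorem sFun_le_iff {α : Type*} [PseudoMetricSpace α] {A : Set α} {r t : ℝ}
    (hN : 0 < _root_.coveringNumber A r) (hr : 0 < r) (hr1 : r < 1) :
    sFun A r ≤ t ↔ (_root_.coveringNumber A r : ℝ) ≤ r ^ (-t) := by
  have hlog : 0 < Real.log (1 / r) := Real.log_pos (by rw [lt_div_iff₀ hr]; linarith)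
  rw [sFun, div_le_iff₀ hlog, Real.le_rpow_iff_log_le (by exact_mod_cast hN) hr,
    Real.log_div one_ne_zero hr.ne', Real.log_one]
  ring_nf

theorem eventually_Ioo_zero_one : ∀ᶠ r : ℝ in 𝓝[>] 0, 0 < r ∧ r < 1 :=
  Ioo_mem_nhdsGT one_pos

theorem eventually_mul_rpow_neg_le {t t' : ℝ} (C : ℝ) (h : t < t') :
    ∀ᶠ r : ℝ in 𝓝[>] 0, C * r ^ (-t) ≤ r ^ (-t') := by
  filter_upwards [(tendsto_rpow_neg_nhdsGT_zero (y := t - t') (by linarith)).eventually_ge_atTop C,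
    eventually_Ioo_zero_one] with r hr hr0
  have := hr0.1
  calc C * r ^ (-t) ≤ r ^ (t - t') * r ^ (-t) := by gcongr
    _ = _ := by rw [← Real.rpow_add hr0.1]; ring_nf

theorem tendsto_const_mul_nhdsGT_zero {c : ℝ} (hc : 0 < c) :
    Tendsto (fun r : ℝ => c * r) (𝓝[>] 0) (𝓝[>] 0) := by
  refine tendsto_nhdsWithin_iff.2 ⟨?_, ?_⟩
  · have : Tendsto (fun r : ℝ => c * r) (𝓝 0) (𝓝 (c * 0)) := by
      exact (continuous_const.mul continuous_id).tendsto 0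
    rw [mul_zero] at this
    exact this.mono_left nhdsWithin_le_nhds
  · filter_upwards [self_mem_nhdsWithin] with r hr
    exact mul_pos hc hr

theorem isBoundedUnder_ge_sFun {α : Type*} [PseudoMetricSpace α] (A : Set α) :
    IsBoundedUnder (· ≥ ·) (𝓝[>] 0) (sFun A) :=
  isBoundedUnder_of_eventually_ge (a := 0) <| by
    filter_upwards [eventually_Ioo_zero_one] with r hr
    exact div_nonneg (Real.log_natCast_nonneg _)
      (Real.log_nonneg (by rw [le_div_iff₀ hr.1]; linarith [hr.2]))

theorem eventually_sFun_mono {α : Type*} [PseudoMetricSpace α] {A B : Set α}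
    (hB : TotallyBounded B) (hne : A.Nonempty) (hAB : A ⊆ B) :
    ∀ᶠ r in 𝓝[>] 0, sFun A r ≤ sFun B r := by
  filter_upwards [eventually_Ioo_zero_one] with r hr
  have h1 := coveringNumber_pos (hB.subset hAB) hne hr.1
  have h2 := coveringNumber_mono hB hAB hr.1
  have hlog : 0 < Real.log (1 / r) := Real.log_pos (by rw [lt_div_iff₀ hr.1]; linarith [hr.2])
  unfold sFun
  gcongr

theorem dimUB_le_of_eventually {α : Type*} [PseudoMetricSpace α] {A : Set α}
    (hA : TotallyBounded A) (hne : A.Nonempty) {c C t : ℝ} (hc : 0 < c)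
    (h : ∀ᶠ r in 𝓝[>] 0, (_root_.coveringNumber A (c * r) : ℝ) ≤ C * r ^ (-t)) :
    dimUB A ≤ t := by
  refine le_of_forall_gt_imp_ge_of_dense fun t' ht' => ?_
  refine limsup_le_of_le (isBoundedUnder_ge_sFun A).isCoboundedUnder_le ?_
  filter_upwards [eventually_Ioo_zero_one,
    (tendsto_const_mul_nhdsGT_zero (inv_pos.2 hc)).eventually h,
    eventually_mul_rpow_neg_le (C * c⁻¹ ^ (-t)) ht'] with r hr h1 h2
  rw [sFun_le_iff (coveringNumber_pos hA hne hr.1) hr.1 hr.2]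
  rw [mul_inv_cancel_left₀ hc.ne', Real.mul_rpow (inv_pos.2 hc).le hr.1.le, ← mul_assoc] at h1
  exact h1.trans h2

theorem dimLB_le_of_frequently {α : Type*} [PseudoMetricSpace α] {A : Set α}
    (hA : TotallyBounded A) (hne : A.Nonempty) {c C t : ℝ} (hc : 0 < c)
    (h : ∃ᶠ r in 𝓝[>] 0, (_root_.coveringNumber A (c * r) : ℝ) ≤ C * r ^ (-t)) :
    dimLB A ≤ t := by
  refine le_of_forall_gt_imp_ge_of_dense fun t' ht' => ?_
  refine liminf_le_of_frequently_le ?_ (isBoundedUnder_ge_sFun A)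
  have h' := h.and_eventually ((tendsto_const_mul_nhdsGT_zero hc).eventually
    (eventually_Ioo_zero_one.and (eventually_mul_rpow_neg_le (C * c⁻¹ ^ (-t)) ht')))
  refine (tendsto_const_mul_nhdsGT_zero hc).frequently (h'.mono fun r hr => ?_)
  obtain ⟨h1, h0, h2⟩ := hr
  rw [sFun_le_iff (coveringNumber_pos hA hne h0.1) h0.1 h0.2]
  refine (h1.trans_eq ?_).trans h2
  rw [mul_assoc, ← Real.mul_rpow (inv_pos.2 hc).le h0.1.le, inv_mul_cancel_left₀ hc.ne']

section FiniteDimensional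

variable {E : Type*} [NormedAddCommGroup E] [NormedSpace ℝ E] [FiniteDimensional ℝ E]
  {A B : Set E}

theorem isBoundedUnder_le_sFun (hA : TotallyBounded A) (hne : A.Nonempty) :
    IsBoundedUnder (· ≤ ·) (𝓝[>] 0) (sFun A) := by
  obtain ⟨C, n, h⟩ := exists_coveringNumber_le_pow hA
  refine isBoundedUnder_of_eventually_le (a := n + 1) ?_
  filter_upwards [eventually_Ioo_zero_one,
    eventually_mul_rpow_neg_le C (t := n) (t' := n + 1) (by linarith)] with r hr hC
  rw [sFun_le_iff (coveringNumber_pos hA hne hr.1) hr.1 hr.2]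
  refine (h r hr.1 hr.2).trans (le_of_eq_of_le ?_ hC)
  rw [Real.rpow_neg hr.1.le, Real.rpow_natCast, one_div, inv_pow]

theorem dimLB_le_dimUB (hA : TotallyBounded A) (hne : A.Nonempty) : dimLB A ≤ dimUB A :=
  liminf_le_limsup (isBoundedUnder_le_sFun hA hne) (isBoundedUnder_ge_sFun A)

theorem dimLB_nonneg (hA : TotallyBounded A) (hne : A.Nonempty) : 0 ≤ dimLB A :=
  le_liminf_of_le (isBoundedUnder_le_sFun hA hne).isCoboundedUnder_ge <| by
    filter_upwards [eventually_Ioo_zero_one] with r hr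
    exact div_nonneg (Real.log_natCast_nonneg _)
      (Real.log_nonneg (by rw [le_div_iff₀ hr.1]; linarith [hr.2]))

theorem dimLB_mono (hB : TotallyBounded B) (hne : A.Nonempty) (hAB : A ⊆ B) :
    dimLB A ≤ dimLB B :=
  liminf_le_liminf (eventually_sFun_mono hB hne hAB) (isBoundedUnder_ge_sFun A)
    (isBoundedUnder_le_sFun hB (hne.mono hAB)).isCoboundedUnder_ge

theorem dimUB_mono (hB : TotallyBounded B) (hne : A.Nonempty) (hAB : A ⊆ B) :
    dimUB A ≤ dimUB B :=
  limsup_le_limsup (eventually_sFun_mono hB hne hAB)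
    (isBoundedUnder_ge_sFun A).isCoboundedUnder_le
    (isBoundedUnder_le_sFun hB (hne.mono hAB))

theorem exists_coveringNumber_le_of_dimUB_lt (hA : TotallyBounded A) (hne : A.Nonempty) {t : ℝ}
    (ht : dimUB A < t) :
    ∃ C : ℝ, 1 ≤ C ∧ ∀ r : ℝ, 0 < r → r < 1 →
      (_root_.coveringNumber A r : ℝ) ≤ C * r ^ (-t) := by
  have ht0 : 0 < t := ((dimLB_nonneg hA hne).trans (dimLB_le_dimUB hA hne)).trans_lt ht
  obtain ⟨ε, hε, h⟩ := mem_nhdsGT_iff_exists_Ioo_subset.1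
    (eventually_lt_of_limsup_lt ht (isBoundedUnder_le_sFun hA hne))
  have hε : 0 < ε := hε
  refine ⟨1 + _root_.coveringNumber A (ε / 2), by simp, fun r hr hr1 => ?_⟩
  have hp : 1 ≤ r ^ (-t) := Real.one_le_rpow_of_pos_of_le_one_of_nonpos hr hr1.le (by linarith)
  have hN : (0 : ℝ) ≤ _root_.coveringNumber A (ε / 2) := Nat.cast_nonneg _
  rcases lt_or_ge r ε with hrε | hrε
  · have h1 := (sFun_le_iff (coveringNumber_pos hA hne hr) hr hr1).1 (le_of_lt (h ⟨hr, hrε⟩))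
    nlinarith
  · have h1 : (_root_.coveringNumber A r : ℝ) ≤ _root_.coveringNumber A (ε / 2) := by
      exact_mod_cast coveringNumber_anti hA (by linarith) (by linarith)
    nlinarith

theorem frequently_coveringNumber_le_of_dimLB_lt (hA : TotallyBounded A) (hne : A.Nonempty) {t : ℝ}
    (ht : dimLB A < t) :
    ∃ᶠ r in 𝓝[>] 0, (_root_.coveringNumber A r : ℝ) ≤ r ^ (-t) := by
  refine ((frequently_lt_of_liminf_lt
    (isBoundedUnder_le_sFun hA hne).isCoboundedUnder_ge ht).and_eventually
    eventually_Ioo_zero_one).mono fun r hr => ?_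
  exact (sFun_le_iff (coveringNumber_pos hA hne hr.2.1) hr.2.1 hr.2.2).1 hr.1.le

theorem dimH_toReal_le_dimLB (hA : TotallyBounded A) (hne : A.Nonempty) :
    (dimH A).toReal ≤ dimLB A := by
  refine le_of_forall_gt_imp_ge_of_dense fun t ht => ?_
  have ht0 : 0 ≤ t := (dimLB_nonneg hA hne).trans ht.le
  let _ : MeasurableSpace E := borel E
  have _ : BorelSpace E := ⟨rfl⟩
  obtain ⟨r, hr, hN⟩ := exists_seq_forall_of_frequently
    ((frequently_coveringNumber_le_of_dimLB_lt hA hne ht).and_eventually eventually_Ioo_zero_one)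
  choose T hTcard hT using fun n => exists_card_eq_coveringNumber hA (hN n).2.1
  have hdiam : ∀ n (x : E), ediam (ball x (r n)) ≤ ENNReal.ofReal (2 * r n) := fun n x =>
    ediam_le_of_forall_dist_le fun y hy z hz => by
      have := dist_triangle_right y z x
      rw [mem_ball] at hy hz
      linarith
  have hr0 : Tendsto (fun n => ENNReal.ofReal (2 * r n)) atTop (𝓝 0) := by
    have h1 : Tendsto (fun n => 2 * r n) atTop (𝓝 0) :=
      ((tendsto_const_mul_nhdsGT_zero two_pos).comp hr).mono_right nhdsWithin_le_nhds
    simpa using ENNReal.tendsto_ofReal h1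
  have hle := Measure.hausdorffMeasure_le_liminf_sum t A (fun n => ENNReal.ofReal (2 * r n)) hr0
    (fun n (x : T n) => ball (x : E) (r n)) (Eventually.of_forall fun n x => hdiam n x)
    (Eventually.of_forall fun n => by
      refine (hT n).trans (iUnion₂_subset fun x hx => ?_)
      exact subset_iUnion (fun x : T n => ball (x : E) (r n)) ⟨x, hx⟩)
  have hbd : ∀ n, ∑ x : T n, ediam (ball (x : E) (r n)) ^ t ≤ ENNReal.ofReal (2 ^ t) := by
    intro n
    obtain ⟨h1, h2, h3⟩ := hN n
    calc ∑ x : T n, ediam (ball (x : E) (r n)) ^ t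
        ≤ ∑ x : T n, ENNReal.ofReal (2 * r n) ^ t := by
          gcongr
          exact hdiam n _
      _ = ENNReal.ofReal ((_root_.coveringNumber A (r n) : ℝ) * (2 * r n) ^ t) := by
          rw [Finset.sum_const, nsmul_eq_mul, Finset.card_univ, Fintype.card_coe, hTcard,
            ENNReal.ofReal_rpow_of_nonneg (by positivity) ht0,
            ENNReal.ofReal_mul (Nat.cast_nonneg _), ENNReal.ofReal_natCast]
      _ ≤ ENNReal.ofReal ((r n) ^ (-t) * (2 * r n) ^ t) := by gcongr
      _ = ENNReal.ofReal (2 ^ t) := by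
          rw [Real.mul_rpow two_pos.le h2.le, mul_left_comm, ← Real.rpow_add h2]
          simp
  have hfin : Measure.hausdorffMeasure t A ≠ ⊤ := by
    refine ne_top_of_le_ne_top (ENNReal.ofReal_ne_top (r := 2 ^ t)) (hle.trans ?_)
    exact (liminf_le_liminf (Eventually.of_forall hbd)).trans_eq (by simp)
  have := dimH_le_of_hausdorffMeasure_ne_top (d := ⟨t, ht0⟩) hfin
  exact ENNReal.toReal_le_of_le_ofReal ht0 (this.trans_eq (ENNReal.ofReal_eq_coe_nnreal ht0).symm)

end FiniteDimensional

namespace CIFS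
variable {d : ℕ} (Φ : CIFS d)

theorem totallyBounded_limitSet : TotallyBounded Φ.limitSet :=
  Φ.hXcompact.totallyBounded.subset Φ.limitSet_subset

theorem totallyBounded_fixedPoints : TotallyBounded Φ.fixedPoints :=
  Φ.totallyBounded_limitSet.subset Φ.fixedPoints_subset_limitSet

theorem limitSet_nonempty : Φ.limitSet.Nonempty :=
  Φ.fixedPoints_nonempty.mono Φ.fixedPoints_subset_limitSet

variable [Nontrivial (EuclideanSpace ℝ (Fin d))]

/-- The limit set at scale `r` is covered by the images of covers of the set of fixed points under
the maps whose contraction ratio is larger than `r`. -/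
theorem exists_coveringNumber_limitSet_le : ∃ C : ℝ, 0 < C ∧ ∀ r : ℝ, 0 < r → r < 1 →
    ∀ W : Finset (List Φ.I), (∀ w, w ∈ W ↔ r < Φ.ratio w) →
      _root_.coveringNumber Φ.limitSet (C * r) ≤
        ∑ w ∈ W, _root_.coveringNumber Φ.fixedPoints (r / Φ.ratio w) := by
  classical
  obtain ⟨C₁, hC₁, hlip⟩ := Φ.exists_dist_le
  have hD : 0 ≤ diam Φ.X := diam_nonneg
  refine ⟨C₁ * diam Φ.X + 2 * C₁ + 1, by positivity, fun r hr hr1 W hW => ?_⟩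
  choose T hTcard hTF hT using fun w => exists_subset_card_le_coveringNumber
    Φ.totallyBounded_fixedPoints Φ.fixedPoints_nonempty (div_pos hr (Φ.ratio_pos w))
  refine (coveringNumber_le_card (W.biUnion fun w => (T w).image (compMaps Φ.S w)) ?_).trans
    (Finset.card_biUnion_le.trans
      (Finset.sum_le_sum fun w _ => Finset.card_image_le.trans (hTcard w)))
  intro x hx
  obtain ⟨γ, hγ⟩ := Φ.mem_limitSet_iff.1 hx
  have hex : ∃ n : ℕ, Φ.ratio (List.ofFn fun k : Fin n => γ k) ≤ r := by
    obtain ⟨n, hn⟩ := exists_pow_lt_of_lt_one hr Φ.hc1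
    refine ⟨n, (Φ.ratio_le_pow _).trans ?_⟩
    rw [List.length_ofFn]
    exact hn.le
  obtain ⟨n, hn, hmin⟩ : ∃ n : ℕ, Φ.ratio (List.ofFn fun k : Fin (n + 1) => γ k) ≤ r ∧
      r < Φ.ratio (List.ofFn fun k : Fin n => γ k) := by
    cases hN : Nat.find hex with
    | zero =>
      have := Nat.find_spec hex
      rw [hN, List.ofFn_zero, Φ.ratio_nil] at this
      linarith
    | succ n =>
      have h1 := Nat.find_spec hex
      rw [hN] at h1
      exact ⟨n, h1, not_le.1 (Nat.find_min hex (by omega))⟩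
  obtain ⟨y, hy, rfl⟩ := hγ (n + 1)
  set w := List.ofFn fun k : Fin n => γ k with hw
  have hsucc : (List.ofFn fun k : Fin (n + 1) => γ k) = w ++ [γ n] := by
    rw [List.ofFn_succ', List.concat_eq_append]
    rfl
  rw [hsucc] at hn ⊢
  obtain ⟨z, hz, hfz⟩ := Φ.exists_fixedPoint (γ n)
  obtain ⟨q, hq, hzq⟩ := hT w z ⟨hz, _, hfz⟩
  refine mem_iUnion₂.2 ⟨compMaps Φ.S w q, Finset.mem_biUnion.2
    ⟨w, (hW w).2 hmin, Finset.mem_image_of_mem _ hq⟩, ?_⟩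
  have h1 := hlip (w ++ [γ n]) y hy z hz
  have h2 : compMaps Φ.S (w ++ [γ n]) z = compMaps Φ.S w z := by
    rw [compMaps_append]
    simp [compMaps, hfz]
  have h3 := hlip w z hz q (hTF w q hq).1
  have h4 := dist_triangle (compMaps Φ.S (w ++ [γ n]) y) (compMaps Φ.S w z) (compMaps Φ.S w q)
  rw [h2] at h1
  have h5 := dist_le_diam_of_mem Φ.hXcompact.isBounded hy hz
  have h6 : C₁ * Φ.ratio (w ++ [γ n]) * dist y z ≤ C₁ * r * diam Φ.X := by gcongr
  have hρ := Φ.ratio_pos w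
  have h7 : C₁ * Φ.ratio w * dist z q ≤ C₁ * Φ.ratio w * (2 * (r / Φ.ratio w)) := by gcongr
  have h8 : C₁ * Φ.ratio w * (2 * (r / Φ.ratio w)) = 2 * C₁ * r := by field_simp
  rw [mem_ball]
  linarith

theorem exists_coveringNumber_limitSet_le_mul {t : ℝ} (ht : (dimH Φ.limitSet).toReal < t) :
    ∃ C G : ℝ, 0 < C ∧ 0 ≤ G ∧ ∀ r : ℝ, 0 < r → r < 1 → ∀ A : ℝ,
      (∀ ρ, r < ρ → ρ ≤ 1 →
        (_root_.coveringNumber Φ.fixedPoints (r / ρ) : ℝ) ≤ A * ρ ^ t) →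
      (_root_.coveringNumber Φ.limitSet (C * r) : ℝ) ≤ A * G := by
  obtain ⟨C, hC, hcov⟩ := Φ.exists_coveringNumber_limitSet_le
  have hsum := Φ.summable_ratio_rpow ht
  have hnonneg : ∀ w, 0 ≤ Φ.ratio w ^ t := fun w => Real.rpow_nonneg (Φ.ratio_pos w).le _
  have ht0 : 0 < t := ENNReal.toReal_nonneg.trans_lt ht
  refine ⟨C, ∑' w, Φ.ratio w ^ t, hC, tsum_nonneg hnonneg, fun r hr hr1 A hA => ?_⟩
  have hfin : {w : List Φ.I | r < Φ.ratio w}.Finite := by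
    have h1 := hsum.tendsto_cofinite_zero.eventually_lt_const (Real.rpow_pos_of_pos hr t)
    refine (eventually_cofinite.1 h1).subset fun w hw => ?_
    simp only [mem_ofPred_eq, not_lt] at hw ⊢
    exact Real.rpow_le_rpow hr.le hw.le ht0.le
  have hA0 : 0 ≤ A := by
    have := hA 1 hr1 le_rfl
    rw [Real.one_rpow, mul_one] at this
    exact (Nat.cast_nonneg _).trans this
  have h1 : (_root_.coveringNumber Φ.limitSet (C * r) : ℝ) ≤
      ∑ w ∈ hfin.toFinset, (_root_.coveringNumber Φ.fixedPoints (r / Φ.ratio w) : ℝ) := by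
    exact_mod_cast hcov r hr hr1 hfin.toFinset (fun w => by simp)
  refine h1.trans ((Finset.sum_le_sum fun w hw =>
    hA (Φ.ratio w) (by simpa using hw) (Φ.ratio_le_one w)).trans ?_)
  rw [← Finset.mul_sum]
  exact mul_le_mul_of_nonneg_left (hsum.sum_le_tsum _ fun w _ => hnonneg w) hA0

theorem dimUB_limitSet_le :
    dimUB Φ.limitSet ≤ max (dimH Φ.limitSet).toReal (dimUB Φ.fixedPoints) := by
  refine le_of_forall_gt_imp_ge_of_dense fun t ht => ?_
  obtain ⟨ht1, ht2⟩ := max_lt_iff.1 ht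
  obtain ⟨C, G, hC, hG, hcov⟩ := Φ.exists_coveringNumber_limitSet_le_mul ht1
  obtain ⟨B, hB, hF⟩ := exists_coveringNumber_le_of_dimUB_lt Φ.totallyBounded_fixedPoints
    Φ.fixedPoints_nonempty ht2
  refine dimUB_le_of_eventually Φ.totallyBounded_limitSet Φ.limitSet_nonempty (c := C)
    (C := B * G) hC ?_
  filter_upwards [eventually_Ioo_zero_one] with r hr
  refine (hcov r hr.1 hr.2 (B * r ^ (-t)) fun ρ hρ hρ1 => ?_).trans_eq (by ring)
  have hρ0 : 0 < ρ := hr.1.trans hρ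
  refine (hF _ (div_pos hr.1 hρ0) ((div_lt_one hρ0).2 hρ)).trans_eq ?_
  rw [Real.div_rpow hr.1.le hρ0.le, Real.rpow_neg hρ0.le, div_inv_eq_mul, mul_assoc]

/-- If the upper box dimension of the fixed point set exceeds both the Hausdorff dimension of the
limit set and the lower box dimension of the fixed point set, then it also exceeds the lower box
dimension of the limit set. -/
theorem dimLB_limitSet_lt (h : max (dimH Φ.limitSet).toReal (dimLB Φ.fixedPoints) <
    dimUB Φ.fixedPoints) : dimLB Φ.limitSet < dimUB Φ.fixedPoints := by
  obtain ⟨h1, h2⟩ := max_lt_iff.1 h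
  set u := dimUB Φ.fixedPoints with hu
  obtain ⟨t, ht, htu⟩ := exists_between h1
  obtain ⟨l, hl, hlu⟩ := exists_between h2
  have ht0 : 0 < t := ENNReal.toReal_nonneg.trans_lt ht
  obtain ⟨δ, hδ, hδ'⟩ : ∃ δ : ℝ, 0 < δ ∧ l + δ * t < u := by
    refine ⟨(u - l) / (2 * t), div_pos (by linarith) (by linarith), ?_⟩
    have : (u - l) / (2 * t) * t = (u - l) / 2 := by field_simp
    linarith
  set v := u + δ * (u - t) with hv
  have hutδ : 0 < δ * (u - t) := mul_pos hδ (by linarith)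
  have hvu : u < v := by linarith
  set q := max (l + δ * t) (v - δ * (v - t)) with hq
  have hqu : q < u := max_lt hδ' (by nlinarith [mul_pos hδ hutδ])
  obtain ⟨C, G, hC, hG, hcov⟩ := Φ.exists_coveringNumber_limitSet_le_mul ht
  obtain ⟨B, hB, hF⟩ := exists_coveringNumber_le_of_dimUB_lt Φ.totallyBounded_fixedPoints
    Φ.fixedPoints_nonempty hvu
  refine lt_of_le_of_lt (dimLB_le_of_frequently Φ.totallyBounded_limitSet Φ.limitSet_nonempty
    (c := C) (C := B * G) (t := q) hC ?_) hqu
  refine ((frequently_coveringNumber_le_of_dimLB_lt Φ.totallyBounded_fixedPoints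
    Φ.fixedPoints_nonempty hl).and_eventually eventually_Ioo_zero_one).mono fun r hr => ?_
  obtain ⟨hN, hr0, hr1⟩ := hr
  refine (hcov r hr0 hr1 (B * r ^ (-q)) fun ρ hρ hρ1 => ?_).trans_eq (by ring)
  have hρ0 : 0 < ρ := hr0.trans hρ
  have hρt : 0 < ρ ^ t := Real.rpow_pos_of_pos hρ0 t
  have hrq : 0 < r ^ (-q) := Real.rpow_pos_of_pos hr0 _
  rcases le_or_gt (r ^ δ) ρ with hρδ | hρδ
  · have h3 : (_root_.coveringNumber Φ.fixedPoints (r / ρ) : ℝ) ≤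
        _root_.coveringNumber Φ.fixedPoints r := by
      exact_mod_cast coveringNumber_anti Φ.totallyBounded_fixedPoints hr0
        (by rw [le_div_iff₀ hρ0]; nlinarith)
    have h4 : r ^ (δ * t) ≤ ρ ^ t := by
      rw [Real.rpow_mul hr0.le]
      exact Real.rpow_le_rpow (Real.rpow_nonneg hr0.le _) hρδ ht0.le
    calc _ ≤ r ^ (-l) := h3.trans hN
      _ = r ^ (-(l + δ * t)) * r ^ (δ * t) := by
        rw [← Real.rpow_add hr0]; ring_nf
      _ ≤ r ^ (-q) * ρ ^ t := by
        refine mul_le_mul ?_ h4 (Real.rpow_nonneg hr0.le _) hrq.le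
        exact Real.rpow_le_rpow_of_exponent_ge hr0 hr1.le (neg_le_neg (le_max_left _ _))
      _ ≤ B * r ^ (-q) * ρ ^ t := by
        nlinarith [mul_pos hrq hρt]
  · have h3 : ρ ^ (v - t) ≤ r ^ (δ * (v - t)) := by
      rw [Real.rpow_mul hr0.le]
      exact Real.rpow_le_rpow hρ0.le hρδ.le (by linarith)
    have h4 : r ^ (-(v - δ * (v - t))) ≤ r ^ (-q) :=
      Real.rpow_le_rpow_of_exponent_ge hr0 hr1.le (neg_le_neg (le_max_right _ _))
    have hrv : 0 < r ^ (-v) := Real.rpow_pos_of_pos hr0 _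
    calc _ ≤ B * (r / ρ) ^ (-v) := hF _ (div_pos hr0 hρ0) ((div_lt_one hρ0).2 hρ)
      _ = B * (r ^ (-v) * ρ ^ (v - t)) * ρ ^ t := by
        rw [Real.div_rpow hr0.le hρ0.le, Real.rpow_neg hρ0.le, div_inv_eq_mul, mul_assoc,
          mul_assoc, ← Real.rpow_add hρ0, sub_add_cancel]
      _ ≤ B * (r ^ (-v) * r ^ (δ * (v - t))) * ρ ^ t := by gcongr
      _ = B * r ^ (-(v - δ * (v - t))) * ρ ^ t := by
        rw [← Real.rpow_add hr0]; ring_nf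
      _ ≤ B * r ^ (-q) * ρ ^ t := by gcongr

end CIFS

/-- The box dimension of the limit set of a CIFS exists if and only if
`dim_UB F ≤ max {dim_H Λ, dim_LB F}`. -/
theorem box_dim_exists_iff {d : ℕ} (hd : 1 ≤ d) (Phi : CIFS d) :
    dimLB Phi.limitSet = dimUB Phi.limitSet ↔
      dimUB Phi.fixedPoints ≤ max (dimH Phi.limitSet).toReal (dimLB Phi.fixedPoints) := by
  have : Nonempty (Fin d) := ⟨⟨0, hd⟩⟩
  have : Nontrivial (EuclideanSpace ℝ (Fin d)) := inferInstance
  have hmono := dimUB_mono Phi.totallyBounded_limitSet Phi.fixedPoints_nonempty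
    Phi.fixedPoints_subset_limitSet
  constructor
  · intro h
    by_contra! hlt
    exact absurd (Phi.dimLB_limitSet_lt hlt) (not_lt.2 (hmono.trans h.ge))
  · intro h
    refine le_antisymm (dimLB_le_dimUB Phi.totallyBounded_limitSet Phi.limitSet_nonempty) ?_
    have hH := dimH_toReal_le_dimLB Phi.totallyBounded_limitSet Phi.limitSet_nonempty
    have hL := dimLB_mono Phi.totallyBounded_limitSet Phi.fixedPoints_nonempty
      Phi.fixedPoints_subset_limitSet
    exact Phi.dimUB_limitSet_le.trans (max_le hH (h.trans (max_le hH hL)))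

end
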